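/- arXiv:2006.02783 — 3 statements merged into one kernel-verified Lean document; each statement's English description precedes it below -/
import Mathlib

section
/- (Weaker version of a lemma of Vu.) For every fixed integer k ≥ 2 there exists a constant h_2(k) = O(8^k·k²) such that for every integer l ≥ h_2(k) there is a constant C (depending on k and l) with the following property: for all positive integers P_1, …, P_l and every positive integer n, the number of l-tuples (y_1, …, y_l) of positive integers with y_i ≤ P_i for each i and y_1^k + … + y_l^k = n is at most C·( (1/n)·Π_{i=1}^l P_i + (Π_{i=1}^l P_i)^{1 − k/l} ). -/
/-- The additive character `α ↦ exp (2 π i n α)`. -/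
noncomputable def expChar (n : ℤ) (α : ℝ) : ℂ :=
  Complex.exp (2 * Real.pi * Complex.I * n * α)

lemma expChar_add (m n : ℤ) (α : ℝ) : expChar (m + n) α = expChar m α * expChar n α := by
  rw [expChar, expChar, expChar, ← Complex.exp_add]
  push_cast
  ring_nf

lemma expChar_zero (α : ℝ) : expChar 0 α = 1 := by simp [expChar]

lemma expChar_mul (m n : ℤ) (α : ℝ) : expChar (m * n) α = expChar n (m * α) := by
  rw [expChar, expChar]
  push_cast
  ring_nf

lemma norm_expChar (n : ℤ) (α : ℝ) : ‖expChar n α‖ = 1 := by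
  have : expChar n α = Complex.exp ((2 * Real.pi * n * α : ℝ) * Complex.I) := by
    rw [expChar]; push_cast; ring_nf
  rw [this, Complex.norm_exp_ofReal_mul_I]

lemma conj_expChar (n : ℤ) (α : ℝ) :
    (starRingEnd ℂ) (expChar n α) = expChar (-n) α := by
  rw [expChar, expChar, ← Complex.exp_conj]
  simp [map_ofNat]

lemma expChar_sum {ι : Type*} (s : Finset ι) (v : ι → ℤ) (α : ℝ) :
    expChar (∑ i ∈ s, v i) α = ∏ i ∈ s, expChar (v i) α := by
  classical
  induction s using Finset.induction_on with
  | empty => simp [expChar_zero]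
  | insert a s ha ih => rw [Finset.sum_insert ha, Finset.prod_insert ha, expChar_add, ih]

@[fun_prop]
lemma continuous_expChar (n : ℤ) : Continuous (expChar n) := by
  unfold expChar
  fun_prop

lemma integral_expChar (n : ℤ) : ∫ α in (0 : ℝ)..1, expChar n α = if n = 0 then 1 else 0 := by
  split_ifs with h
  · simp [h, expChar_zero]
  · unfold expChar
    have hc : (2 * Real.pi * Complex.I * n : ℂ) ≠ 0 := by
      simp [h, Real.pi_ne_zero]
    rw [integral_exp_mul_complex hc]
    have : Complex.exp (2 * Real.pi * Complex.I * n * (1 : ℝ)) = 1 := by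
      rw [Complex.exp_eq_one_iff]
      exact ⟨n, by push_cast; ring⟩
    rw [this]
    simp

lemma norm_integral_pow_three_le {ι : Type*} (s : Finset ι) (v : ι → ℤ) (u : ι → ℂ) {M : ℝ}
    (hM : ∀ i ∈ s, ‖u i‖ ≤ M) :
    ‖∫ α in (0 : ℝ)..1, (∑ i ∈ s, u i * expChar (v i) α) ^ 3‖ ≤
      M ^ 3 * ((s ×ˢ s ×ˢ s).filter fun p => v p.1 + v p.2.1 + v p.2.2 = 0).card := by
  have h : ∀ α : ℝ, (∑ i ∈ s, u i * expChar (v i) α) ^ 3 =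
      ∑ p ∈ s ×ˢ s ×ˢ s, u p.1 * u p.2.1 * u p.2.2 *
        expChar (v p.1 + v p.2.1 + v p.2.2) α := by
    intro α
    rw [pow_three, Finset.sum_mul_sum, Finset.sum_mul_sum, Finset.sum_product]
    refine Finset.sum_congr rfl fun i _ => ?_
    rw [Finset.sum_product]
    simp_rw [Finset.mul_sum]
    refine Finset.sum_congr rfl fun j _ => Finset.sum_congr rfl fun k _ => ?_
    rw [expChar_add, expChar_add]
    ring
  simp_rw [h]
  rw [intervalIntegral.integral_finsetSum
    (fun p _ => (Continuous.intervalIntegrable (by fun_prop) _ _))]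
  simp_rw [intervalIntegral.integral_const_mul, integral_expChar]
  refine (norm_sum_le _ _).trans ?_
  rw [mul_comm, ← nsmul_eq_mul, ← Finset.sum_const, Finset.sum_filter]
  refine Finset.sum_le_sum fun p hp => ?_
  simp only [Finset.mem_product] at hp
  split_ifs
  · rw [mul_one, norm_mul, norm_mul, pow_three, ← mul_assoc]
    have h1 := hM _ hp.1
    have h2 := hM _ hp.2.1
    have h3 := hM _ hp.2.2
    have h0 : 0 ≤ M := (norm_nonneg _).trans h1
    gcongr
  · simp

/-- `F` is a trigonometric polynomial with frequencies in `[-B, B]`. -/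
def IsTrigPoly (B : ℤ) (F : ℝ → ℂ) : Prop :=
  ∃ u : ℤ → ℂ, ∀ α, F α = ∑ z ∈ Finset.Icc (-B) B, u z * expChar z α

lemma isTrigPoly_sum {ι : Type*} (s : Finset ι) (u : ι → ℂ) (v : ι → ℤ) {B : ℤ}
    (hv : ∀ i ∈ s, |v i| ≤ B) : IsTrigPoly B fun α => ∑ i ∈ s, u i * expChar (v i) α := by
  refine ⟨fun z => ∑ i ∈ s with v i = z, u i, fun α => ?_⟩
  have hm : ∀ i ∈ s, v i ∈ Finset.Icc (-B) B := fun i hi => by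
    rw [Finset.mem_Icc]; exact abs_le.mp (hv i hi)
  simp only
  rw [← Finset.sum_fiberwise_of_maps_to hm]
  refine Finset.sum_congr rfl fun z _ => ?_
  rw [Finset.sum_mul]
  refine Finset.sum_congr rfl fun i hi => ?_
  rw [(Finset.mem_filter.mp hi).2]

lemma IsTrigPoly.mul {B B' : ℤ} {F G : ℝ → ℂ} (hF : IsTrigPoly B F) (hG : IsTrigPoly B' G) :
    IsTrigPoly (B + B') fun α => F α * G α := by
  obtain ⟨u, hu⟩ := hF
  obtain ⟨w, hw⟩ := hG
  have h := isTrigPoly_sum (Finset.Icc (-B) B ×ˢ Finset.Icc (-B') B')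
    (fun p => u p.1 * w p.2) (fun p => p.1 + p.2) (B := B + B') (fun p hp => by
      simp only [Finset.mem_product, Finset.mem_Icc] at hp
      rw [abs_le]; constructor <;> linarith [hp.1.1, hp.1.2, hp.2.1, hp.2.2])
  convert h using 2 with α
  rw [hu, hw, Finset.sum_mul_sum, Finset.sum_product]
  refine Finset.sum_congr rfl fun x _ => Finset.sum_congr rfl fun y _ => ?_
  rw [expChar_add]
  ring

lemma IsTrigPoly.pow {B : ℤ} {F : ℝ → ℂ} (hF : IsTrigPoly B F) (s : ℕ) :
    IsTrigPoly (s * B) fun α => F α ^ s := by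
  induction s with
  | zero => exact ⟨fun _ => 1, fun α => by simp [expChar_zero]⟩
  | succ s ih =>
    have := ih.mul hF
    simp_rw [← pow_succ] at this
    convert this using 1
    push_cast; ring

lemma IsTrigPoly.exists_coeff_le {B : ℤ} {F : ℝ → ℂ} (hF : IsTrigPoly B F) :
    ∃ u : ℤ → ℂ, (∀ α, F α = ∑ z ∈ Finset.Icc (-B) B, u z * expChar z α) ∧
      ∀ z ∈ Finset.Icc (-B) B, ‖u z‖ ≤ ∫ α in (0 : ℝ)..1, ‖F α‖ := by
  obtain ⟨u, hu⟩ := hF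
  refine ⟨u, hu, fun z hz => ?_⟩
  have h : ∫ α in (0 : ℝ)..1, F α * expChar (-z) α = u z := by
    simp_rw [hu, Finset.sum_mul, mul_assoc, ← expChar_add]
    rw [intervalIntegral.integral_finsetSum
      (fun p _ => (Continuous.intervalIntegrable (by fun_prop) _ _))]
    simp_rw [intervalIntegral.integral_const_mul, integral_expChar]
    rw [Finset.sum_eq_single_of_mem z hz]
    · simp
    · intro w _ hw
      rw [if_neg (by omega), mul_zero]
  rw [← h]
  refine (intervalIntegral.norm_integral_le_integral_norm zero_le_one).trans_eq ?_
  simp_rw [norm_mul, norm_expChar, mul_one]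

lemma normSq_sum_range_le (w : ℕ → ℂ) (hw : ∀ x, ‖w x‖ = 1) {N P : ℕ} (hN : N ≤ P) :
    ‖∑ x ∈ Finset.range N, w x‖ ^ 2 ≤ P + 2 * ∑ h ∈ Finset.Ioc 0 P,
      ‖∑ x ∈ Finset.range (N - h), w (x + h) * (starRingEnd ℂ) (w x)‖ := by
  have hind : ∀ N : ℕ, ‖∑ x ∈ Finset.range N, w x‖ ^ 2 =
      N + 2 * (∑ y ∈ Finset.range N, ∑ x ∈ Finset.range y,
        w y * (starRingEnd ℂ) (w x)).re := by
    intro N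
    induction N with
    | zero => simp
    | succ N ih =>
      rw [Finset.sum_range_succ, Finset.sum_range_succ, ← Complex.normSq_eq_norm_sq,
        Complex.normSq_add, Complex.normSq_eq_norm_sq, ih, Complex.normSq_eq_norm_sq, hw,
        ← Finset.mul_sum, ← map_sum, Complex.add_re]
      push_cast
      have : ∀ a b : ℂ, (a * (starRingEnd ℂ) b).re = (b * (starRingEnd ℂ) a).re := by
        intro a b; simp; ring
      rw [this (w N)]
      ring
  have hre : ∑ y ∈ Finset.range N, ∑ x ∈ Finset.range y, w y * (starRingEnd ℂ) (w x) =
      ∑ h ∈ Finset.Ioc 0 P, ∑ x ∈ Finset.range (N - h),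
        w (x + h) * (starRingEnd ℂ) (w x) := by
    rw [Finset.sum_sigma', Finset.sum_sigma']
    refine Finset.sum_nbij' (fun p => ⟨p.1 - p.2, p.2⟩) (fun p => ⟨p.2 + p.1, p.2⟩) ?_ ?_ ?_ ?_ ?_
    · rintro ⟨y, x⟩ h
      simp only [Finset.mem_sigma, Finset.mem_range, Finset.mem_Ioc] at h ⊢
      omega
    · rintro ⟨y, x⟩ h
      simp only [Finset.mem_sigma, Finset.mem_range, Finset.mem_Ioc] at h ⊢
      omega
    · rintro ⟨y, x⟩ h
      simp only [Finset.mem_sigma, Finset.mem_range] at h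
      simp only [Sigma.mk.injEq, heq_eq_eq, and_true]
      omega
    · rintro ⟨y, x⟩ h
      simp
    · rintro ⟨y, x⟩ h
      simp only [Finset.mem_sigma, Finset.mem_range] at h
      simp only
      rw [show x + (y - x) = y by omega]
  rw [hind, hre]
  have h1 := (Complex.re_le_norm (∑ h ∈ Finset.Ioc 0 P, ∑ x ∈ Finset.range (N - h),
        w (x + h) * (starRingEnd ℂ) (w x))).trans (norm_sum_le _ _)
  have h2 : (N : ℝ) ≤ P := by exact_mod_cast hN
  linarith

lemma card_mul_le_of_dvd_sub {s : Finset ℤ} {B e : ℕ} (he : 0 < e) (heB : e ≤ B)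
    (hs : s ⊆ Finset.Icc (-(B : ℤ)) B) (hd : ∀ x ∈ s, ∀ y ∈ s, (e : ℤ) ∣ x - y) :
    s.card * e ≤ 3 * B := by
  have he' : (0 : ℤ) < e := by exact_mod_cast he
  have hcard : s.card ≤ (Finset.Icc (0 : ℤ) ((2 * B : ℕ) / e : ℕ)).card := by
    refine Finset.card_le_card_of_injOn (fun x => (x + B) / e) ?_ ?_
    · intro x hx
      have := Finset.mem_Icc.mp (hs hx)
      simp only [Finset.coe_Icc, Set.mem_Icc]
      refine ⟨Int.ediv_nonneg (by linarith) he'.le, ?_⟩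
      push_cast
      exact Int.ediv_le_ediv he' (by linarith)
    · intro x hx y hy hxy
      simp only at hxy
      have h1 : (e : ℤ) ∣ (x + B) - (y + B) := by
        simpa using hd x hx y hy
      have h3 : (x + B) % e = (y + B) % e := Int.emod_eq_emod_iff_emod_sub_eq_zero.mpr
        (Int.emod_eq_zero_of_dvd h1)
      have h4 := Int.mul_ediv_add_emod (x + B) e
      have h5 := Int.mul_ediv_add_emod (y + B) e
      rw [hxy, h3] at h4
      linarith
  have h2 : (Finset.Icc (0 : ℤ) ((2 * B : ℕ) / e : ℕ)).card = 2 * B / e + 1 := by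
    rw [Int.card_Icc, sub_zero]
    exact_mod_cast Int.toNat_natCast (2 * B / e + 1)
  rw [h2] at hcard
  calc s.card * e ≤ (2 * B / e + 1) * e := Nat.mul_le_mul_right _ hcard
    _ = 2 * B / e * e + e := by ring
    _ ≤ 2 * B + B := Nat.add_le_add (Nat.div_mul_le_self _ _) heB
    _ = 3 * B := by ring

/-- The integer zeros of the linear form with coefficients `a`, `b`, `c` in the box
`[-B, B] ^ 3`. -/
noncomputable def linearZeros (a b c B : ℕ) : Finset (ℤ × ℤ × ℤ) :=
  (Finset.Icc (-(B : ℤ)) B ×ˢ Finset.Icc (-(B : ℤ)) B ×ˢ Finset.Icc (-(B : ℤ)) B).filter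
    fun z => a * z.1 + b * z.2.1 + c * z.2.2 = 0

lemma mem_linearZeros {a b c B : ℕ} {z : ℤ × ℤ × ℤ} :
    z ∈ linearZeros a b c B ↔ (z.1 ∈ Finset.Icc (-(B : ℤ)) B ∧ z.2.1 ∈ Finset.Icc (-(B : ℤ)) B ∧
      z.2.2 ∈ Finset.Icc (-(B : ℤ)) B) ∧ a * z.1 + b * z.2.1 + c * z.2.2 = 0 := by
  simp only [linearZeros, Finset.mem_filter, Finset.mem_product]

lemma card_linearZeros_mul_le {a b c B : ℕ} (ha : 0 < a) (haB : a ≤ B) :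
    (linearZeros a b c B).card * a ≤ 9 * B ^ 2 * ((a.gcd b).gcd c) := by
  set d := a.gcd b with hd
  have hd0 : 0 < d := Nat.gcd_pos_of_pos_left _ ha
  have hg0 : 0 < d.gcd c := Nat.gcd_pos_of_pos_left _ hd0
  obtain ⟨a', b', hab, ha', hb'⟩ := Nat.exists_coprime a b
  obtain ⟨e, c', hec, he, hc'⟩ := Nat.exists_coprime d c
  rw [← hd] at ha' hb'
  set g := d.gcd c with hg
  have ha0 : 0 < a' := Nat.pos_of_ne_zero (by rintro rfl; omega)
  have he0 : 0 < e := Nat.pos_of_ne_zero (by rintro rfl; omega)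
  have haB' : a' ≤ B := (Nat.le_of_dvd ha ⟨d, ha'⟩).trans haB
  have heB : e ≤ B := ((Nat.le_of_dvd hd0 ⟨g, he⟩).trans
    (Nat.le_of_dvd ha (Nat.gcd_dvd_left a b))).trans haB
  have hdZ : (d : ℤ) ≠ 0 := by exact_mod_cast hd0.ne'
  have hgZ : (g : ℤ) ≠ 0 := by exact_mod_cast hg0.ne'
  have haZ : (a : ℤ) = a' * d := by exact_mod_cast ha'
  have hbZ : (b : ℤ) = b' * d := by exact_mod_cast hb'
  have hcZ : (c : ℤ) = c' * g := by exact_mod_cast hc'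
  have heZ : (d : ℤ) = e * g := by exact_mod_cast he
  have himage : ((linearZeros a b c B).image fun z => z.2.2).card * e ≤ 3 * B := by
    have hdvd : ∀ x ∈ (linearZeros a b c B).image (fun z => z.2.2), (e : ℤ) ∣ x := by
      intro x hx
      obtain ⟨z, hz, rfl⟩ := Finset.mem_image.mp hx
      have h := (mem_linearZeros.mp hz).2
      have h1 : (c' : ℤ) * z.2.2 = e * -(a' * z.1 + b' * z.2.1) := by
        apply mul_right_cancel₀ hgZ
        rw [haZ, hbZ, hcZ, heZ] at h
        linear_combination h
      exact (Nat.isCoprime_iff_coprime.mpr hec).dvd_of_dvd_mul_left ⟨_, h1⟩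
    refine card_mul_le_of_dvd_sub he0 heB ?_ fun x hx y hy => dvd_sub (hdvd x hx) (hdvd y hy)
    intro x hx
    obtain ⟨z, hz, rfl⟩ := Finset.mem_image.mp hx
    exact (mem_linearZeros.mp hz).1.2.2
  have hfiber : ∀ x ∈ (linearZeros a b c B).image (fun z => z.2.2),
      ((linearZeros a b c B).filter fun z => z.2.2 = x).card ≤ 3 * B / a' := by
    intro x _
    rw [Nat.le_div_iff_mul_le ha0]
    set F := (linearZeros a b c B).filter fun z => z.2.2 = x with hF
    have hinj : Set.InjOn (fun z : ℤ × ℤ × ℤ => z.2.1) F := by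
      rintro ⟨x1, x2, x3⟩ hx ⟨y1, y2, y3⟩ hy hxy
      simp only [hF, Finset.coe_filter, Set.mem_ofPred_eq, mem_linearZeros] at hx hy hxy
      obtain ⟨⟨-, hx⟩, rfl⟩ := hx
      obtain ⟨⟨-, hy⟩, rfl⟩ := hy
      subst hxy
      have : (a : ℤ) * x1 = a * y1 := by linarith
      have := mul_left_cancel₀ (by exact_mod_cast ha.ne') this
      simp [this]
    rw [← Finset.card_image_of_injOn hinj]
    refine card_mul_le_of_dvd_sub ha0 haB' ?_ ?_
    · intro x hx
      obtain ⟨z, hz, rfl⟩ := Finset.mem_image.mp hx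
      exact (mem_linearZeros.mp (Finset.mem_filter.mp hz).1).1.2.1
    · intro p hp q hq
      obtain ⟨⟨x1, x2, x3⟩, hx, rfl⟩ := Finset.mem_image.mp hp
      obtain ⟨⟨y1, y2, y3⟩, hy, rfl⟩ := Finset.mem_image.mp hq
      simp only [hF, Finset.mem_filter, mem_linearZeros] at hx hy
      obtain ⟨⟨-, hx⟩, rfl⟩ := hx
      obtain ⟨⟨-, hy⟩, rfl⟩ := hy
      have h1 : (b' : ℤ) * (x2 - y2) = a' * (y1 - x1) := by
        apply mul_right_cancel₀ hdZ
        rw [haZ, hbZ] at hx hy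
        linear_combination hx - hy
      exact (Nat.isCoprime_iff_coprime.mpr hab).dvd_of_dvd_mul_left ⟨_, h1⟩
  have hcard := Finset.card_le_mul_card_image _ _ hfiber
  have hag : a = a' * e * g := by rw [mul_assoc, ← he]; exact ha'
  calc (linearZeros a b c B).card * a
      ≤ (3 * B / a' * ((linearZeros a b c B).image fun z => z.2.2).card) * (a' * e * g) := by
        rw [← hag]; exact Nat.mul_le_mul_right _ hcard
    _ = (3 * B / a' * a') * (((linearZeros a b c B).image fun z => z.2.2).card * e) * g := by
        ring
    _ ≤ (3 * B) * (3 * B) * g := by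
        exact Nat.mul_le_mul_right _ (Nat.mul_le_mul (Nat.div_mul_le_self _ _) himage)
    _ = 9 * B ^ 2 * g := by ring

lemma card_linearZeros_swap (a b c B : ℕ) :
    (linearZeros a b c B).card = (linearZeros b a c B).card := by
  refine Finset.card_nbij' (fun z => (z.2.1, z.1, z.2.2)) (fun z => (z.2.1, z.1, z.2.2))
    ?_ ?_ (fun _ _ => rfl) (fun _ _ => rfl) <;>
  · intro z hz
    simp only [Finset.mem_coe, mem_linearZeros] at hz ⊢
    exact ⟨⟨hz.1.2.1, hz.1.1, hz.1.2.2⟩, by linarith [hz.2]⟩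

lemma card_linearZeros_le {a b c B : ℕ} (ha : 0 < a) (hb : 0 < b) (haB : a ≤ B) (hbB : b ≤ B) :
    ((linearZeros a b c B).card : ℝ) ≤ 9 * B ^ 2 * (((a.gcd b).gcd c : ℕ) / (max a b : ℕ)) := by
  have h : (linearZeros a b c B).card * max a b ≤ 9 * B ^ 2 * ((a.gcd b).gcd c) := by
    rcases max_choice a b with h | h
    · rw [h]; exact card_linearZeros_mul_le ha haB
    · rw [h, card_linearZeros_swap, Nat.gcd_comm a b]; exact card_linearZeros_mul_le hb hbB
  have hm : (0 : ℝ) < (max a b : ℕ) := by exact_mod_cast lt_max_of_lt_left ha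
  rw [← mul_div_assoc, le_div_iff₀ hm]
  exact_mod_cast h

lemma sum_div_max_le (A : ℕ) {g : ℕ} (hg : 0 < g) :
    ∑ a ∈ Finset.Ioc 0 A with g ∣ a, ∑ b ∈ Finset.Ioc 0 A with g ∣ b, (g : ℝ) / (max a b : ℕ) ≤
      2 * (A / g) := by
  have hg' : (0 : ℝ) < g := by exact_mod_cast hg
  set S := (Finset.Ioc 0 A).filter (g ∣ ·) with hS
  have hhalf : ∑ a ∈ S, ∑ b ∈ S, (if b ≤ a then (g : ℝ) / a else 0) ≤ A / g := by
    have h1 : ∀ a ∈ S, ∑ b ∈ S, (if b ≤ a then (g : ℝ) / a else 0) ≤ 1 := by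
      intro a ha
      simp only [hS, Finset.mem_filter, Finset.mem_Ioc] at ha
      have ha0 : (0 : ℝ) < a := by exact_mod_cast ha.1.1
      rw [← Finset.sum_filter, Finset.sum_const, nsmul_eq_mul]
      have h2 : (S.filter (· ≤ a)).card ≤ a / g := by
        rw [← Nat.Ioc_filter_dvd_card_eq_div]
        apply Finset.card_le_card
        intro b hb
        simp only [hS, Finset.mem_filter, Finset.mem_Ioc] at hb ⊢
        exact ⟨⟨hb.1.1.1, hb.2⟩, hb.1.2⟩
      have h3 : ((S.filter (· ≤ a)).card : ℝ) ≤ a / g :=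
        (Nat.cast_le.mpr h2).trans Nat.cast_div_le
      calc ((S.filter (· ≤ a)).card : ℝ) * (g / a) ≤ a / g * (g / a) := by gcongr
        _ = 1 := by field_simp
    refine (Finset.sum_le_sum h1).trans ?_
    rw [Finset.sum_const, nsmul_eq_mul, mul_one, hS, Nat.Ioc_filter_dvd_card_eq_div]
    exact Nat.cast_div_le
  calc ∑ a ∈ S, ∑ b ∈ S, (g : ℝ) / (max a b : ℕ)
      ≤ ∑ a ∈ S, ∑ b ∈ S, ((if b ≤ a then (g : ℝ) / a else 0) +
          (if a ≤ b then (g : ℝ) / b else 0)) := by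
        refine Finset.sum_le_sum fun a _ => Finset.sum_le_sum fun b _ => ?_
        rcases le_total a b with h | h
        · rw [max_eq_right h, if_pos h]
          have : (0 : ℝ) ≤ if b ≤ a then (g : ℝ) / a else 0 := by positivity
          linarith
        · rw [max_eq_left h, if_pos h]
          have : (0 : ℝ) ≤ if a ≤ b then (g : ℝ) / b else 0 := by positivity
          linarith
    _ = ∑ a ∈ S, ∑ b ∈ S, (if b ≤ a then (g : ℝ) / a else 0) +
          ∑ b ∈ S, ∑ a ∈ S, (if a ≤ b then (g : ℝ) / b else 0) := by
        simp_rw [Finset.sum_add_distrib]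
        congr 1
        exact Finset.sum_comm
    _ ≤ 2 * (A / g) := by linarith

lemma sum_gcd_div_max_le (A : ℕ) :
    ∑ a ∈ Finset.Ioc 0 A, ∑ b ∈ Finset.Ioc 0 A, ∑ c ∈ Finset.Ioc 0 A,
      (((a.gcd b).gcd c : ℕ) : ℝ) / (max a b : ℕ) ≤ 4 * A ^ 2 := by
  set I := Finset.Ioc 0 A with hI
  have h1 : ∀ a ∈ I, ∀ b ∈ I, ∀ c ∈ I, (((a.gcd b).gcd c : ℕ) : ℝ) / (max a b : ℕ) ≤
      ∑ g ∈ I, if g ∣ a then if g ∣ b then if g ∣ c then (g : ℝ) / (max a b : ℕ)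
        else 0 else 0 else 0 := by
    intro a ha b _ c _
    rw [hI, Finset.mem_Ioc] at ha
    have hdvd : (a.gcd b).gcd c ∣ a := (Nat.gcd_dvd_left _ _).trans (Nat.gcd_dvd_left _ _)
    have hm : (a.gcd b).gcd c ∈ I := by
      rw [hI, Finset.mem_Ioc]
      exact ⟨Nat.pos_of_dvd_of_pos hdvd ha.1, (Nat.le_of_dvd ha.1 hdvd).trans ha.2⟩
    refine le_trans (le_of_eq ?_) (Finset.single_le_sum (fun g _ => ?_) hm)
    · rw [if_pos hdvd, if_pos ((Nat.gcd_dvd_left _ _).trans (Nat.gcd_dvd_right _ _)),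
        if_pos (Nat.gcd_dvd_right _ _)]
    · positivity
  calc _ ≤ ∑ a ∈ I, ∑ b ∈ I, ∑ c ∈ I, ∑ g ∈ I, (if g ∣ a then if g ∣ b then if g ∣ c then
        (g : ℝ) / (max a b : ℕ) else 0 else 0 else 0) :=
        Finset.sum_le_sum fun a ha => Finset.sum_le_sum fun b hb =>
          Finset.sum_le_sum fun c hc => h1 a ha b hb c hc
    _ = ∑ g ∈ I, ∑ a ∈ I, ∑ b ∈ I, ∑ c ∈ I, (if g ∣ a then if g ∣ b then if g ∣ c then
        (g : ℝ) / (max a b : ℕ) else 0 else 0 else 0) := by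
        symm
        rw [Finset.sum_comm]
        refine Finset.sum_congr rfl fun a _ => ?_
        rw [Finset.sum_comm]
        exact Finset.sum_congr rfl fun b _ => Finset.sum_comm
    _ ≤ ∑ g ∈ I, 2 * (A : ℝ) ^ 2 * ((g : ℝ) ^ 2)⁻¹ := by
        refine Finset.sum_le_sum fun g hg => ?_
        rw [hI, Finset.mem_Ioc] at hg
        have hg' : (0 : ℝ) < g := by exact_mod_cast hg.1
        have h2 : ∑ a ∈ I, ∑ b ∈ I, ∑ c ∈ I, (if g ∣ a then if g ∣ b then if g ∣ c then
            (g : ℝ) / (max a b : ℕ) else 0 else 0 else 0) =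
            (A / g : ℕ) * ∑ a ∈ I with g ∣ a, ∑ b ∈ I with g ∣ b, (g : ℝ) / (max a b : ℕ) := by
          rw [Finset.mul_sum, Finset.sum_filter]
          refine Finset.sum_congr rfl fun a _ => ?_
          split_ifs
          · rw [Finset.mul_sum, Finset.sum_filter]
            refine Finset.sum_congr rfl fun b _ => ?_
            split_ifs
            · rw [← Finset.sum_filter, Finset.sum_const, hI, Nat.Ioc_filter_dvd_card_eq_div,
                nsmul_eq_mul]
            · simp
          · simp
        rw [h2]
        calc ((A / g : ℕ) : ℝ) *
              ∑ a ∈ I with g ∣ a, ∑ b ∈ I with g ∣ b, (g : ℝ) / (max a b : ℕ)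
            ≤ (A / g) * (2 * (A / g)) := by
              gcongr
              · exact Nat.cast_div_le
              · exact sum_div_max_le A hg.1
          _ = 2 * (A : ℝ) ^ 2 * ((g : ℝ) ^ 2)⁻¹ := by field_simp
    _ ≤ 2 * (A : ℝ) ^ 2 * 2 := by
        rw [← Finset.mul_sum]
        gcongr
        have := sum_Ioo_inv_sq_le (α := ℝ) 0 (A + 1)
        have hII : Finset.Ioo 0 (A + 1) = I := by ext; simp [hI]
        rw [hII] at this
        simpa using this
    _ = 4 * (A : ℝ) ^ 2 := by ring

lemma card_bilinearZeros_le {A B : ℕ} (hAB : A ≤ B) :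
    (((((Finset.Ioc 0 A ×ˢ Finset.Icc (-(B : ℤ)) B) ×ˢ (Finset.Ioc 0 A ×ˢ Finset.Icc (-(B : ℤ)) B)
      ×ˢ (Finset.Ioc 0 A ×ˢ Finset.Icc (-(B : ℤ)) B))).filter fun p =>
        (p.1.1 : ℤ) * p.1.2 + (p.2.1.1 : ℤ) * p.2.1.2 + (p.2.2.1 : ℤ) * p.2.2.2 = 0).card : ℝ) ≤
      36 * A ^ 2 * B ^ 2 := by
  set Z := (((Finset.Ioc 0 A ×ˢ Finset.Icc (-(B : ℤ)) B) ×ˢ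
    (Finset.Ioc 0 A ×ˢ Finset.Icc (-(B : ℤ)) B) ×ˢ
    (Finset.Ioc 0 A ×ˢ Finset.Icc (-(B : ℤ)) B))).filter (fun p =>
        (p.1.1 : ℤ) * p.1.2 + (p.2.1.1 : ℤ) * p.2.1.2 + (p.2.2.1 : ℤ) * p.2.2.2 = 0) with hZ
  set I := Finset.Ioc 0 A with hI
  have hmaps : ∀ p ∈ Z, (p.1.1, p.2.1.1, p.2.2.1) ∈ I ×ˢ I ×ˢ I := by
    intro p hp
    simp only [hZ, Finset.mem_filter, Finset.mem_product] at hp ⊢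
    exact ⟨hp.1.1.1, hp.1.2.1.1, hp.1.2.2.1⟩
  rw [Finset.card_eq_sum_card_fiberwise hmaps, Nat.cast_sum, Finset.sum_product]
  simp_rw [Finset.sum_product]
  calc _ ≤ ∑ a ∈ I, ∑ b ∈ I, ∑ c ∈ I,
        9 * (B : ℝ) ^ 2 * ((((a.gcd b).gcd c : ℕ) : ℝ) / (max a b : ℕ)) := by
        refine Finset.sum_le_sum fun a ha => Finset.sum_le_sum fun b hb =>
          Finset.sum_le_sum fun c _ => ?_
        rw [hI, Finset.mem_Ioc] at ha hb
        refine le_trans ?_ (card_linearZeros_le ha.1 hb.1 (ha.2.trans hAB) (hb.2.trans hAB))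
        rw [Nat.cast_le]
        refine Finset.card_le_card_of_injOn (fun p => (p.1.2, p.2.1.2, p.2.2.2)) ?_ ?_
        · rintro ⟨⟨h1, z1⟩, ⟨h2, z2⟩, ⟨h3, z3⟩⟩ hp
          simp only [hZ, Finset.coe_filter, Finset.mem_filter, Finset.mem_product,
            Set.mem_ofPred_eq, Prod.mk.injEq] at hp
          obtain ⟨⟨⟨h1, h2, h3⟩, h4⟩, rfl, rfl, rfl⟩ := hp
          exact mem_linearZeros.mpr ⟨⟨h1.2, h2.2, h3.2⟩, h4⟩
        · rintro ⟨⟨h1, z1⟩, ⟨h2, z2⟩, ⟨h3, z3⟩⟩ hp ⟨⟨h1', z1'⟩, ⟨h2', z2'⟩, ⟨h3', z3'⟩⟩ hq hpq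
          simp only [Finset.coe_filter, Set.mem_ofPred_eq, Prod.mk.injEq] at hp hq hpq ⊢
          obtain ⟨-, rfl, rfl, rfl⟩ := hp
          obtain ⟨-, rfl, rfl, rfl⟩ := hq
          tauto
    _ = 9 * (B : ℝ) ^ 2 * ∑ a ∈ I, ∑ b ∈ I, ∑ c ∈ I,
        (((a.gcd b).gcd c : ℕ) : ℝ) / (max a b : ℕ) := by
        simp_rw [Finset.mul_sum]
    _ ≤ 9 * (B : ℝ) ^ 2 * (4 * A ^ 2) := by
        gcongr
        exact sum_gcd_div_max_le A
    _ = 36 * A ^ 2 * B ^ 2 := by ring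

/-- The value at `x` of the polynomial of degree at most `n` with coefficients `a`. -/
def polyEval (a : ℕ → ℤ) (n x : ℕ) : ℤ := ∑ j ∈ Finset.range (n + 1), a j * (x : ℤ) ^ j

/-- The coefficients of `(f (x + h) - f x) / h`, where `f` has degree at most `n` and
coefficients `a`. -/
def diffCoeff (a : ℕ → ℤ) (n h i : ℕ) : ℤ :=
  ∑ j ∈ Finset.Ioc i n, a j * j.choose i * (h : ℤ) ^ (j - 1 - i)

lemma polyEval_add_sub (a : ℕ → ℤ) (n x h : ℕ) :
    polyEval a (n + 1) (x + h) - polyEval a (n + 1) x =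
      h * polyEval (diffCoeff a (n + 1) h) n x := by
  have hpow : ∀ j : ℕ, ((x + h : ℕ) : ℤ) ^ j - (x : ℤ) ^ j =
      ∑ i ∈ Finset.range j, h * ((x : ℤ) ^ i * (h : ℤ) ^ (j - 1 - i) * j.choose i) := by
    intro j
    push_cast
    rw [add_pow, Finset.sum_range_succ]
    simp only [Nat.sub_self, pow_zero, mul_one, Nat.choose_self, Nat.cast_one,
      add_sub_cancel_right]
    refine Finset.sum_congr rfl fun i hi => ?_
    rw [Finset.mem_range] at hi
    rw [show j - i = (j - 1 - i) + 1 by omega, pow_succ]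
    ring
  simp only [polyEval, diffCoeff]
  rw [← Finset.sum_sub_distrib]
  simp_rw [← mul_sub, hpow, Finset.mul_sum, Finset.sum_mul, Finset.mul_sum]
  rw [Finset.sum_comm' (s' := fun i => Finset.Ioc i (n + 1)) (t' := Finset.range (n + 1))]
  · refine Finset.sum_congr rfl fun i _ => Finset.sum_congr rfl fun j _ => ?_
    ring
  · intro j i
    simp only [Finset.mem_range, Finset.mem_Ioc]
    omega

lemma diffCoeff_top (a : ℕ → ℤ) (n h : ℕ) :
    diffCoeff a (n + 1) h n = (n + 1) * a (n + 1) := by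
  have : Finset.Ioc n (n + 1) = {n + 1} := by
    ext; simp only [Finset.mem_Ioc, Finset.mem_singleton]; omega
  rw [diffCoeff, this, Finset.sum_singleton, Nat.choose_succ_self_right]
  simp
  ring

lemma abs_diffCoeff_le {a : ℕ → ℤ} {n h c P : ℕ} (hh : h ≤ P)
    (ha : ∀ j ≤ n + 1, |a j| ≤ c * (P : ℤ) ^ (n + 1 - j)) {i : ℕ} (hi : i ≤ n) :
    |diffCoeff a (n + 1) h i| ≤ (c * (n + 1) * 2 ^ (n + 1) : ℕ) * (P : ℤ) ^ (n - i) := by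
  have hh' : (h : ℤ) ≤ P := by exact_mod_cast hh
  have hterm : ∀ j ∈ Finset.Ioc i (n + 1), |a j * j.choose i * (h : ℤ) ^ (j - 1 - i)| ≤
      c * 2 ^ (n + 1) * (P : ℤ) ^ (n - i) := by
    intro j hj
    rw [Finset.mem_Ioc] at hj
    rw [abs_mul, abs_mul, Nat.abs_cast, abs_pow, Nat.abs_cast]
    have h1 : (j.choose i : ℤ) ≤ 2 ^ (n + 1) := by
      exact_mod_cast (Nat.choose_le_two_pow j i).trans (Nat.pow_le_pow_right two_pos hj.2)
    calc |a j| * (j.choose i : ℤ) * (h : ℤ) ^ (j - 1 - i)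
        ≤ (c * (P : ℤ) ^ (n + 1 - j)) * 2 ^ (n + 1) * (P : ℤ) ^ (j - 1 - i) := by
          have := ha j hj.2
          gcongr
      _ = c * 2 ^ (n + 1) * ((P : ℤ) ^ (n + 1 - j) * (P : ℤ) ^ (j - 1 - i)) := by ring
      _ = c * 2 ^ (n + 1) * (P : ℤ) ^ (n - i) := by
          rw [← pow_add]; congr 2; omega
  refine (Finset.abs_sum_le_sum_abs _ _).trans ((Finset.sum_le_sum hterm).trans ?_)
  rw [Finset.sum_const, Nat.card_Ioc, nsmul_eq_mul]
  have h2 : ((n + 1 - i : ℕ) : ℤ) ≤ n + 1 := by omega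
  calc ((n + 1 - i : ℕ) : ℤ) * (c * 2 ^ (n + 1) * (P : ℤ) ^ (n - i))
      ≤ (n + 1) * (c * 2 ^ (n + 1) * (P : ℤ) ^ (n - i)) := by gcongr
    _ = (c * (n + 1) * 2 ^ (n + 1) : ℕ) * (P : ℤ) ^ (n - i) := by push_cast; ring

lemma abs_polyEval_le {a : ℕ → ℤ} {n c P x : ℕ} (hx : x ≤ P)
    (ha : ∀ j ≤ n, |a j| ≤ c * (P : ℤ) ^ (n - j)) :
    |polyEval a n x| ≤ ((n + 1) * c * P ^ n : ℕ) := by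
  have hx' : (x : ℤ) ≤ P := by exact_mod_cast hx
  have hterm : ∀ j ∈ Finset.range (n + 1), |a j * (x : ℤ) ^ j| ≤ c * (P : ℤ) ^ n := by
    intro j hj
    have hj' : j ≤ n := Finset.mem_range_succ_iff.mp hj
    rw [abs_mul, abs_pow, Nat.abs_cast]
    calc |a j| * (x : ℤ) ^ j ≤ c * (P : ℤ) ^ (n - j) * (P : ℤ) ^ j := by
          have := ha j hj'
          gcongr
      _ = c * (P : ℤ) ^ n := by rw [mul_assoc, ← pow_add, Nat.sub_add_cancel hj']
  refine (Finset.abs_sum_le_sum_abs _ _).trans ((Finset.sum_le_sum hterm).trans ?_)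
  rw [Finset.sum_const, Finset.card_range, nsmul_eq_mul]
  push_cast
  linarith

/-- The Weyl sum of length `N` of the polynomial of degree at most `n` with coefficients `a`. -/
noncomputable def weylSum (a : ℕ → ℤ) (n N : ℕ) (α : ℝ) : ℂ :=
  ∑ x ∈ Finset.range N, expChar (polyEval a n x) α

@[fun_prop]
lemma continuous_weylSum (a : ℕ → ℤ) (n N : ℕ) : Continuous (weylSum a n N) := by
  unfold weylSum
  fun_prop

lemma weylSum_diffCoeff (a : ℕ → ℤ) (n N h : ℕ) (α : ℝ) :
    weylSum (diffCoeff a (n + 1) h) n N (h * α) =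
      ∑ x ∈ Finset.range N, expChar (polyEval a (n + 1) (x + h)) α *
        (starRingEnd ℂ) (expChar (polyEval a (n + 1) x) α) := by
  refine Finset.sum_congr rfl fun x _ => ?_
  rw [conj_expChar, ← expChar_add, ← sub_eq_add_neg, polyEval_add_sub, expChar_mul,
    Int.cast_natCast]

lemma isTrigPoly_normSq_weylSum_pow {a : ℕ → ℤ} {n c P N : ℕ} (hN : N ≤ P)
    (ha : ∀ j ≤ n, |a j| ≤ c * (P : ℤ) ^ (n - j)) (s : ℕ) :
    IsTrigPoly ((s * (2 * ((n + 1) * c * P ^ n)) : ℕ) : ℤ)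
      fun α => ((‖weylSum a n N α‖ ^ (2 * s) : ℝ) : ℂ) := by
  have hb : ∀ x ∈ Finset.range N, |polyEval a n x| ≤ ((n + 1) * c * P ^ n : ℕ) := fun x hx =>
    abs_polyEval_le ((Finset.mem_range.mp hx).le.trans hN) ha
  have h1 := isTrigPoly_sum (Finset.range N) (fun _ => 1) (polyEval a n) hb
  have h2 := isTrigPoly_sum (Finset.range N) (fun _ => 1) (fun x => -polyEval a n x)
    (fun x hx => by rw [abs_neg]; exact hb x hx)
  convert (h1.mul h2).pow s using 2 with α
  · push_cast; ring
  · simp_rw [one_mul, ← conj_expChar, ← map_sum]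
    rw [Complex.mul_conj, Complex.normSq_eq_norm_sq, pow_mul]
    push_cast
    rfl

lemma integral_normSq_linear_weylSum (a : ℕ → ℤ) (N : ℕ) (ha : a 1 ≠ 0) :
    ∫ α in (0 : ℝ)..1, ‖weylSum a 1 N α‖ ^ 2 = N := by
  have h : ∫ α in (0 : ℝ)..1, ((‖weylSum a 1 N α‖ ^ 2 : ℝ) : ℂ) = N := by
    have h1 : ∀ α, ((‖weylSum a 1 N α‖ ^ 2 : ℝ) : ℂ) =
        ∑ x ∈ Finset.range N, ∑ y ∈ Finset.range N,
          expChar (polyEval a 1 x - polyEval a 1 y) α := by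
      intro α
      rw [← Complex.normSq_eq_norm_sq, ← Complex.mul_conj, weylSum, map_sum,
        Finset.sum_mul_sum]
      simp_rw [conj_expChar, ← expChar_add, ← sub_eq_add_neg]
    simp_rw [h1]
    rw [intervalIntegral.integral_finsetSum
      (fun p _ => (Continuous.intervalIntegrable (by fun_prop) _ _))]
    have h2 : ∀ x ∈ Finset.range N, ∫ α in (0 : ℝ)..1, ∑ y ∈ Finset.range N,
        expChar (polyEval a 1 x - polyEval a 1 y) α = 1 := by
      intro x hx
      rw [intervalIntegral.integral_finsetSum
        (fun p _ => (Continuous.intervalIntegrable (by fun_prop) _ _))]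
      simp_rw [integral_expChar]
      rw [Finset.sum_eq_single_of_mem x hx]
      · simp
      · intro y _ hy
        rw [if_neg]
        simp only [polyEval, Finset.sum_range_succ, Finset.sum_range_zero, pow_one]
        intro h
        have : a 1 * ((x : ℤ) - y) = 0 := by linarith
        rcases mul_eq_zero.mp this with h | h
        · exact ha h
        · omega
    rw [Finset.sum_congr rfl h2]
    simp
  rw [intervalIntegral.integral_ofReal] at h
  exact_mod_cast h

lemma sum_pow_le_card_pow_mul {A : ℕ} (hA : 0 < A) {f : ℕ → ℝ} (hf : ∀ h, 0 ≤ f h) (m : ℕ) :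
    (∑ h ∈ Finset.Ioc 0 A, f h) ^ (m + 1) ≤
      (A : ℝ) ^ m * ∑ h ∈ Finset.Ioc 0 A, f h ^ (m + 1) := by
  have h := pow_sum_div_card_le_sum_pow (s := Finset.Ioc 0 A) (f := f)
    (fun h _ => hf h) m
  rw [Nat.card_Ioc, Nat.sub_zero, div_le_iff₀ (by positivity)] at h
  linarith

lemma integral_sum_diff_pow_three_le {a : ℕ → ℤ} {n c P N s : ℕ} {M : ℝ} (hc : 0 < c)
    (hs : 0 < s) (hN : N ≤ P)
    (ha : ∀ h ∈ Finset.Ioc 0 P, ∀ j ≤ n + 1,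
      |diffCoeff a (n + 2) h j| ≤ c * (P : ℤ) ^ (n + 1 - j))
    (hM : ∀ h ∈ Finset.Ioc 0 P, ∫ α in (0 : ℝ)..1,
      ‖weylSum (diffCoeff a (n + 2) h) (n + 1) (N - h) α‖ ^ (2 * s) ≤ M) :
    ∫ α in (0 : ℝ)..1, (∑ h ∈ Finset.Ioc 0 P,
      ‖weylSum (diffCoeff a (n + 2) h) (n + 1) (N - h) (h * α)‖ ^ (2 * s)) ^ 3 ≤
      M ^ 3 * (36 * (P : ℝ) ^ 2 * ((s * (2 * ((n + 2) * c * P ^ (n + 1))) : ℕ) : ℝ) ^ 2) := by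
  set B := s * (2 * ((n + 2) * c * P ^ (n + 1))) with hB
  rcases Nat.eq_zero_or_pos P with rfl | hP
  · simp
  have hPB : P ≤ B := by
    rw [hB, pow_succ]
    have : 0 < s * 2 * (n + 2) * c * P ^ n := by positivity
    calc P = 1 * P := by ring
      _ ≤ (s * 2 * (n + 2) * c * P ^ n) * P := Nat.mul_le_mul_right _ this
      _ = _ := by ring
  have hu : ∀ h ∈ Finset.Ioc 0 P, ∃ u : ℤ → ℂ,
      (∀ α, ((‖weylSum (diffCoeff a (n + 2) h) (n + 1) (N - h) α‖ ^ (2 * s) : ℝ) : ℂ) =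
        ∑ z ∈ Finset.Icc (-(B : ℤ)) B, u z * expChar z α) ∧
      ∀ z ∈ Finset.Icc (-(B : ℤ)) B, ‖u z‖ ≤ M := by
    intro h hh
    obtain ⟨u, hu1, hu2⟩ := (isTrigPoly_normSq_weylSum_pow ((Nat.sub_le N h).trans hN)
      (ha h hh) s).exists_coeff_le
    refine ⟨u, hu1, fun z hz => (hu2 z hz).trans (le_trans (le_of_eq ?_) (hM h hh))⟩
    simp
  choose! u hu1 hu2 using hu
  have hexp : ∀ α : ℝ, ((∑ h ∈ Finset.Ioc 0 P,
      ‖weylSum (diffCoeff a (n + 2) h) (n + 1) (N - h) (h * α)‖ ^ (2 * s) : ℝ) : ℂ) =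
      ∑ p ∈ Finset.Ioc 0 P ×ˢ Finset.Icc (-(B : ℤ)) B,
        u p.1 p.2 * expChar ((p.1 : ℤ) * p.2) α := by
    intro α
    rw [Complex.ofReal_sum, Finset.sum_product]
    refine Finset.sum_congr rfl fun h hh => ?_
    rw [hu1 h hh]
    simp_rw [expChar_mul, Int.cast_natCast]
  have hmain := norm_integral_pow_three_le (Finset.Ioc 0 P ×ˢ Finset.Icc (-(B : ℤ)) B)
    (fun p => (p.1 : ℤ) * p.2) (fun p => u p.1 p.2) (M := M) (fun p hp => by
      rw [Finset.mem_product] at hp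
      exact hu2 _ hp.1 _ hp.2)
  simp_rw [← hexp, ← Complex.ofReal_pow] at hmain
  rw [intervalIntegral.integral_ofReal, Complex.norm_real] at hmain
  have hM0 : 0 ≤ M := by
    refine le_trans ?_ (hM 1 (by simp; omega))
    exact intervalIntegral.integral_nonneg zero_le_one fun _ _ => by positivity
  refine (Real.le_norm_self _).trans (hmain.trans ?_)
  gcongr
  exact card_bilinearZeros_le hPB

theorem exists_integral_weylSum_pow_le (n c : ℕ) :
    ∃ C : ℝ, 0 ≤ C ∧ ∀ P N : ℕ, 1 ≤ P → N ≤ P → ∀ a : ℕ → ℤ, a (n + 1) ≠ 0 →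
      (∀ j ≤ n + 1, |a j| ≤ c * (P : ℤ) ^ (n + 1 - j)) →
      (∫ α in (0 : ℝ)..1, ‖weylSum a (n + 1) N α‖ ^ (2 * 6 ^ n)) * (P : ℝ) ^ (n + 1) ≤
        C * (P : ℝ) ^ (2 * 6 ^ n) := by
  induction n generalizing c with
  | zero =>
    refine ⟨1, zero_le_one, fun P N _ hN a ha _ => ?_⟩
    rw [zero_add, pow_zero, mul_one, integral_normSq_linear_weylSum a N ha]
    have : (N : ℝ) ≤ P := by exact_mod_cast hN
    rw [pow_one, one_mul, sq]
    gcongr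
  | succ n ih =>
    set c' := c * (n + 2) * 2 ^ (n + 2) + 1 with hc'
    obtain ⟨C, hC, hI⟩ := ih c'
    set s := 6 ^ n with hs
    have hs0 : 0 < s := by positivity
    set B₀ : ℝ := s * (2 * ((n + 2) * c')) with hB₀
    refine ⟨2 ^ (6 * s) * (1 + 2 ^ (6 * s) * (C ^ 3 * (36 * B₀ ^ 2))), by positivity,
      fun P N hP hN a ha haP => ?_⟩
    have hP1 : (1 : ℝ) ≤ P := by exact_mod_cast hP
    have hPpos : (0 : ℝ) < P := by linarith
    have hcoeff : ∀ h ∈ Finset.Ioc 0 P, ∀ j ≤ n + 1,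
        |diffCoeff a (n + 2) h j| ≤ c' * (P : ℤ) ^ (n + 1 - j) := by
      intro h hh j hj
      refine (abs_diffCoeff_le (Finset.mem_Ioc.mp hh).2 haP hj).trans ?_
      gcongr
      exact Nat.le_succ _
    set M : ℝ := C * (P : ℝ) ^ (2 * s) / (P : ℝ) ^ (n + 1) with hM
    have hMP : M * (P : ℝ) ^ (n + 1) = C * (P : ℝ) ^ (2 * s) :=
      div_mul_cancel₀ _ (by positivity)
    have hMle : ∀ h ∈ Finset.Ioc 0 P, ∫ α in (0 : ℝ)..1,
        ‖weylSum (diffCoeff a (n + 2) h) (n + 1) (N - h) α‖ ^ (2 * s) ≤ M := by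
      intro h hh
      rw [hM, le_div_iff₀ (by positivity)]
      refine hI P (N - h) hP ((Nat.sub_le N h).trans hN) _ ?_ (hcoeff h hh)
      rw [diffCoeff_top]
      exact mul_ne_zero (by positivity) ha
    have hthree := integral_sum_diff_pow_three_le (by omega) hs0 hN hcoeff hMle
    set T : ℝ → ℝ := fun α => ∑ h ∈ Finset.Ioc 0 P,
      ‖weylSum (diffCoeff a (n + 2) h) (n + 1) (N - h) (h * α)‖ ^ (2 * s) with hT
    have hTc : Continuous T := by fun_prop
    obtain ⟨m, hm⟩ : ∃ m, 2 * s = m + 1 := ⟨2 * s - 1, by omega⟩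
    have hpoint : ∀ α, ‖weylSum a (n + 2) N α‖ ^ (2 * 6 ^ (n + 1)) ≤
        2 ^ (6 * s) * ((P : ℝ) ^ (6 * s) + 2 ^ (6 * s) * ((P : ℝ) ^ (3 * m) * T α ^ 3)) := by
      intro α
      have h1 := normSq_sum_range_le (fun x => expChar (polyEval a (n + 2) x) α)
        (fun x => norm_expChar _ _) hN
      simp_rw [← weylSum_diffCoeff a (n + 1) _ _ α] at h1
      set V := ∑ h ∈ Finset.Ioc 0 P,
        ‖weylSum (diffCoeff a (n + 2) h) (n + 1) (N - h) (h * α)‖ with hV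
      have hV0 : 0 ≤ V := Finset.sum_nonneg fun _ _ => norm_nonneg _
      have h2 : V ^ (m + 1) ≤ (P : ℝ) ^ m * T α := by
        have := sum_pow_le_card_pow_mul hP (f := fun h : ℕ =>
          ‖weylSum (diffCoeff a (n + 2) h) (n + 1) (N - h) (h * α)‖)
          (fun _ => norm_nonneg _) m
        rwa [← hm] at this ⊢
      calc ‖weylSum a (n + 2) N α‖ ^ (2 * 6 ^ (n + 1))
          = (‖weylSum a (n + 2) N α‖ ^ 2) ^ (6 * s) := by rw [← pow_mul, pow_succ, hs]; ring_nf
        _ ≤ (P + 2 * V) ^ (6 * s) := by gcongr; exact h1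
        _ ≤ 2 ^ (6 * s - 1) * ((P : ℝ) ^ (6 * s) + (2 * V) ^ (6 * s)) :=
            add_pow_le hPpos.le (by positivity) _
        _ ≤ 2 ^ (6 * s) * ((P : ℝ) ^ (6 * s) + (2 * V) ^ (6 * s)) := by
            gcongr
            · norm_num
            · omega
        _ = 2 ^ (6 * s) * ((P : ℝ) ^ (6 * s) + 2 ^ (6 * s) * (V ^ (m + 1)) ^ 3) := by
            rw [mul_pow, ← pow_mul, ← hm]; ring_nf
        _ ≤ 2 ^ (6 * s) * ((P : ℝ) ^ (6 * s) + 2 ^ (6 * s) * ((P : ℝ) ^ m * T α) ^ 3) := by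
            gcongr
        _ = _ := by rw [mul_pow, ← pow_mul, mul_comm m 3]
    have hint : ∫ α in (0 : ℝ)..1, ‖weylSum a (n + 2) N α‖ ^ (2 * 6 ^ (n + 1)) ≤
        2 ^ (6 * s) * ((P : ℝ) ^ (6 * s) + 2 ^ (6 * s) * ((P : ℝ) ^ (3 * m) *
          ∫ α in (0 : ℝ)..1, T α ^ 3)) := by
      refine (intervalIntegral.integral_mono zero_le_one
        (Continuous.intervalIntegrable (by fun_prop) _ _)
        (Continuous.intervalIntegrable (by fun_prop) _ _) hpoint).trans_eq ?_
      rw [intervalIntegral.integral_const_mul, intervalIntegral.integral_add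
        (Continuous.intervalIntegrable (by fun_prop) _ _)
        (Continuous.intervalIntegrable (by fun_prop) _ _), intervalIntegral.integral_const_mul,
        intervalIntegral.integral_const_mul]
      simp
    have hexp : n + 2 ≤ 6 * s := by
      have : n < 6 ^ n := Nat.lt_pow_self (by norm_num)
      omega
    have hBcast : ((s * (2 * ((n + 2) * c' * P ^ (n + 1))) : ℕ) : ℝ) =
        B₀ * (P : ℝ) ^ (n + 1) := by
      rw [hB₀]; push_cast; ring
    rw [hBcast] at hthree
    calc (∫ α in (0 : ℝ)..1, ‖weylSum a (n + 2) N α‖ ^ (2 * 6 ^ (n + 1))) * (P : ℝ) ^ (n + 2)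
        ≤ (2 ^ (6 * s) * ((P : ℝ) ^ (6 * s) + 2 ^ (6 * s) * ((P : ℝ) ^ (3 * m) *
          (M ^ 3 * (36 * (P : ℝ) ^ 2 * (B₀ * (P : ℝ) ^ (n + 1)) ^ 2))))) * (P : ℝ) ^ (n + 2) := by
          gcongr
          exact hint.trans (by gcongr)
      _ = 2 ^ (6 * s) * ((P : ℝ) ^ (6 * s) * (P : ℝ) ^ (n + 2) + 2 ^ (6 * s) *
          (((P : ℝ) ^ (m + 1)) ^ 3 * ((M * (P : ℝ) ^ (n + 1)) ^ 3 * (36 * B₀ ^ 2)))) := by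
          ring
      _ = 2 ^ (6 * s) * ((P : ℝ) ^ (6 * s) * (P : ℝ) ^ (n + 2) + 2 ^ (6 * s) *
          ((P : ℝ) ^ (12 * s) * (C ^ 3 * (36 * B₀ ^ 2)))) := by
          rw [hMP, ← hm]; ring
      _ ≤ 2 ^ (6 * s) * ((P : ℝ) ^ (6 * s) * (P : ℝ) ^ (6 * s) + 2 ^ (6 * s) *
          ((P : ℝ) ^ (12 * s) * (C ^ 3 * (36 * B₀ ^ 2)))) := by
          gcongr
      _ = 2 ^ (6 * s) * (1 + 2 ^ (6 * s) * (C ^ 3 * (36 * B₀ ^ 2))) *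
          (P : ℝ) ^ (2 * 6 ^ (n + 1)) := by
          rw [show 2 * 6 ^ (n + 1) = 12 * s by rw [hs]; ring]; ring

lemma polyEval_choose (k x : ℕ) :
    polyEval (fun j => k.choose j) k x = ((x + 1 : ℕ) : ℤ) ^ k := by
  push_cast
  rw [add_pow, polyEval]
  refine Finset.sum_congr rfl fun j _ => ?_
  ring

lemma ncard_le_integral_prod_norm_weylSum {l : ℕ} (k n : ℕ) (P : Fin l → ℕ) :
    ({y : Fin l → ℕ | (∀ i, 1 ≤ y i ∧ y i ≤ P i) ∧ ∑ i, (y i) ^ k = n}.ncard : ℝ) ≤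
      ∫ α in (0 : ℝ)..1, ∏ i, ‖weylSum (fun j => k.choose j) k (P i) α‖ := by
  set S := Fintype.piFinset fun i => Finset.range (P i) with hS
  have hcard : {y : Fin l → ℕ | (∀ i, 1 ≤ y i ∧ y i ≤ P i) ∧ ∑ i, (y i) ^ k = n}.ncard ≤
      (S.filter fun x => ∑ i, (x i + 1) ^ k = n).card := by
    refine le_trans (Set.ncard_le_ncard
      (t := ((S.filter fun x => ∑ i, (x i + 1) ^ k = n).image fun x i => x i + 1 :
        Finset (Fin l → ℕ))) ?_ (Finset.finite_toSet _)) ?_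
    · rintro y ⟨hy, hyn⟩
      have hsub : ∀ i, y i - 1 + 1 = y i := fun i => Nat.sub_add_cancel (hy i).1
      rw [Finset.mem_coe, Finset.mem_image]
      refine ⟨fun i => y i - 1, ?_, funext hsub⟩
      rw [Finset.mem_filter, hS, Fintype.mem_piFinset]
      simp_rw [hsub, Finset.mem_range]
      refine ⟨fun i => ?_, hyn⟩
      have := hy i
      omega
    · rw [Set.ncard_coe_finset]
      exact Finset.card_image_le
  have hprod : ∀ α, (∏ i, weylSum (fun j => k.choose j) k (P i) α) * expChar (-n) α =
      ∑ x ∈ S, expChar (∑ i, ((x i + 1 : ℕ) : ℤ) ^ k - n) α := by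
    intro α
    simp_rw [weylSum, polyEval_choose]
    rw [Finset.prod_univ_sum, Finset.sum_mul]
    simp_rw [← expChar_sum, ← expChar_add, ← sub_eq_add_neg]
    rfl
  have hint : ∫ α in (0 : ℝ)..1,
      (∏ i, weylSum (fun j => k.choose j) k (P i) α) * expChar (-n) α =
        ((S.filter fun x => ∑ i, (x i + 1) ^ k = n).card : ℂ) := by
    simp_rw [hprod]
    rw [intervalIntegral.integral_finsetSum
      (fun p _ => (Continuous.intervalIntegrable (by fun_prop) _ _))]
    simp_rw [integral_expChar, sub_eq_zero]
    rw [Finset.sum_boole]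
    congr 3
    ext x
    exact_mod_cast Iff.rfl
  have hnorm := intervalIntegral.norm_integral_le_integral_norm (f := fun α =>
    (∏ i, weylSum (fun j => k.choose j) k (P i) α) * expChar (-n) α) (μ := MeasureTheory.volume)
    (zero_le_one (α := ℝ))
  rw [hint, Complex.norm_natCast] at hnorm
  simp_rw [norm_mul, norm_expChar, mul_one, norm_prod] at hnorm
  exact (Nat.cast_le.mpr hcard).trans hnorm

lemma norm_weylSum_le (a : ℕ → ℤ) (n N : ℕ) (α : ℝ) : ‖weylSum a n N α‖ ≤ N := by
  refine (norm_sum_le _ _).trans_eq ?_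
  simp [norm_expChar]

lemma exists_integral_powSum_le (m : ℕ) : ∃ C : ℝ, 0 ≤ C ∧ ∀ l P : ℕ, 2 * 6 ^ m ≤ l → 1 ≤ P →
    (∫ α in (0 : ℝ)..1, ‖weylSum (fun j => (m + 1).choose j) (m + 1) P α‖ ^ l) *
      (P : ℝ) ^ (m + 1) ≤ C * (P : ℝ) ^ l := by
  obtain ⟨C, hC, h⟩ := exists_integral_weylSum_pow_le m (2 ^ (m + 1))
  refine ⟨C, hC, fun l P hl hP => ?_⟩
  obtain ⟨r, rfl⟩ := Nat.exists_eq_add_of_le hl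
  have hmain := h P P hP le_rfl (fun j => (m + 1).choose j) (by simp) (by
    intro j _
    rw [Nat.abs_cast]
    have h1 : (m + 1).choose j ≤ 2 ^ (m + 1) := Nat.choose_le_two_pow _ _
    have h2 : 1 ≤ P ^ (m + 1 - j) := Nat.one_le_pow _ _ hP
    exact_mod_cast h1.trans (Nat.le_mul_of_pos_right _ h2))
  have hle : ∫ α in (0 : ℝ)..1,
      ‖weylSum (fun j => (m + 1).choose j) (m + 1) P α‖ ^ (2 * 6 ^ m + r) ≤
      (∫ α in (0 : ℝ)..1,
        ‖weylSum (fun j => (m + 1).choose j) (m + 1) P α‖ ^ (2 * 6 ^ m)) * (P : ℝ) ^ r := by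
    rw [← intervalIntegral.integral_mul_const]
    refine intervalIntegral.integral_mono zero_le_one
      (Continuous.intervalIntegrable (by fun_prop) _ _)
      (Continuous.intervalIntegrable (by fun_prop) _ _) fun α => ?_
    simp only [pow_add]
    gcongr
    exact norm_weylSum_le _ _ _ _
  calc _ ≤ ((∫ α in (0 : ℝ)..1,
        ‖weylSum (fun j => (m + 1).choose j) (m + 1) P α‖ ^ (2 * 6 ^ m)) * (P : ℝ) ^ r) *
          (P : ℝ) ^ (m + 1) := by gcongr
    _ = ((∫ α in (0 : ℝ)..1,
        ‖weylSum (fun j => (m + 1).choose j) (m + 1) P α‖ ^ (2 * 6 ^ m)) *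
          (P : ℝ) ^ (m + 1)) * (P : ℝ) ^ r := by ring
    _ ≤ (C * (P : ℝ) ^ (2 * 6 ^ m)) * (P : ℝ) ^ r := by gcongr
    _ = C * (P : ℝ) ^ (2 * 6 ^ m + r) := by ring

lemma prod_le_sum_pow {l : ℕ} (hl : 0 < l) {x : Fin l → ℝ} (hx : ∀ i, 0 ≤ x i) :
    ∏ i, x i ≤ ∑ i, x i ^ l := by
  have : Nonempty (Fin l) := ⟨⟨0, hl⟩⟩
  obtain ⟨i, hi⟩ := Finite.exists_max x
  calc ∏ j, x j ≤ ∏ _j : Fin l, x i :=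
        Finset.prod_le_prod (fun j _ => hx j) fun j _ => hi j
    _ = x i ^ l := by simp
    _ ≤ ∑ j, x j ^ l :=
        Finset.single_le_sum (f := fun j => x j ^ l) (fun j _ => pow_nonneg (hx j) l)
          (Finset.mem_univ i)

theorem stmt15 :
    ∃ D : ℝ, 0 < D ∧ ∀ k : ℕ, 2 ≤ k →
      ∃ h2 : ℕ, (h2 : ℝ) ≤ D * 8 ^ k * k ^ 2 ∧
        ∀ l : ℕ, h2 ≤ l → ∃ C : ℝ, 0 < C ∧
          ∀ P : Fin l → ℕ, (∀ i, 1 ≤ P i) → ∀ n : ℕ, 1 ≤ n →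
            ({y : Fin l → ℕ | (∀ i, 1 ≤ y i ∧ y i ≤ P i) ∧
                ∑ i, (y i) ^ k = n}.ncard : ℝ) ≤
              C * ((1 / (n : ℝ)) * ∏ i, (P i : ℝ) +
                (∏ i, (P i : ℝ)) ^ (1 - (k : ℝ) / (l : ℝ))) := by
  refine ⟨1, one_pos, fun k hk => ?_⟩
  obtain ⟨m, rfl⟩ : ∃ m, k = m + 1 := ⟨k - 1, by omega⟩
  refine ⟨2 * 6 ^ m, ?_, fun l hl => ?_⟩
  · have h1 : (2 : ℝ) * 6 ^ m ≤ 8 * 8 ^ m := by gcongr <;> norm_num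
    have h2 : (1 : ℝ) ≤ ((m + 1 : ℕ) : ℝ) ^ 2 := one_le_pow₀ (by simp)
    push_cast at h2 ⊢
    calc (2 : ℝ) * 6 ^ m ≤ 8 * 8 ^ m * 1 := by linarith
      _ ≤ 8 * 8 ^ m * ((m : ℝ) + 1) ^ 2 := by gcongr
      _ = _ := by ring
  · have hl0 : 0 < l := lt_of_lt_of_le (by positivity) hl
    have hlR : (l : ℝ) ≠ 0 := by exact_mod_cast hl0.ne'
    obtain ⟨C, hC, hI⟩ := exists_integral_powSum_le m
    refine ⟨l * C + 1, by positivity, fun P hP n hn => ?_⟩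
    have hPpos : ∀ i, (0 : ℝ) < P i := fun i => by exact_mod_cast hP i
    set θ : ℝ := 1 - ((m + 1 : ℕ) : ℝ) / l with hθ
    set w : Fin l → ℝ := fun i => (P i : ℝ) ^ θ with hw
    have hw0 : ∀ i, 0 < w i := fun i => Real.rpow_pos_of_pos (hPpos i) _
    have hwl : ∀ i, w i ^ l * (P i : ℝ) ^ (m + 1) = (P i : ℝ) ^ l := by
      intro i
      rw [hw]
      simp only
      rw [← Real.rpow_mul_natCast (hPpos i).le, ← Real.rpow_natCast, ← Real.rpow_natCast,
        ← Real.rpow_add (hPpos i)]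
      congr 1
      rw [hθ]
      field_simp
      ring
    set F : Fin l → ℝ → ℝ :=
      fun i α => ‖weylSum (fun j => (m + 1).choose j) (m + 1) (P i) α‖ with hF
    have hFc : ∀ i, Continuous (F i) := fun i => by fun_prop
    have hFint : ∀ i, ∫ α in (0 : ℝ)..1, F i α ^ l ≤ C * w i ^ l := by
      intro i
      refine le_of_mul_le_mul_right ?_ (pow_pos (hPpos i) (m + 1))
      rw [mul_assoc, hwl]
      exact hI l (P i) hl (hP i)
    have hpoint : ∀ α, ∏ i, F i α ≤ (∏ i, w i) * ∑ i, F i α ^ l / w i ^ l := by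
      intro α
      have h := prod_le_sum_pow hl0 (x := fun i => F i α / w i)
        fun i => div_nonneg (norm_nonneg _) (hw0 i).le
      simp_rw [div_pow] at h
      rw [Finset.prod_div_distrib, div_le_iff₀ (Finset.prod_pos fun i _ => hw0 i)] at h
      linarith
    have hbound : ∫ α in (0 : ℝ)..1, ∏ i, F i α ≤ (∏ i, w i) * (l * C) := by
      refine (intervalIntegral.integral_mono zero_le_one
        (Continuous.intervalIntegrable (by fun_prop) _ _)
        (Continuous.intervalIntegrable (by fun_prop) _ _) hpoint).trans ?_
      rw [intervalIntegral.integral_const_mul]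
      refine mul_le_mul_of_nonneg_left ?_ (Finset.prod_nonneg fun i _ => (hw0 i).le)
      rw [intervalIntegral.integral_finsetSum
        (fun i _ => (Continuous.intervalIntegrable (by fun_prop) _ _))]
      calc ∑ i, ∫ α in (0 : ℝ)..1, F i α ^ l / w i ^ l ≤ ∑ _i : Fin l, C := by
            refine Finset.sum_le_sum fun i _ => ?_
            rw [intervalIntegral.integral_div, div_le_iff₀ (pow_pos (hw0 i) l)]
            exact hFint i
        _ = l * C := by simp
    have hprod : ∏ i, w i = (∏ i, (P i : ℝ)) ^ θ :=
      Real.finsetProd_rpow _ _ (fun i _ => (hPpos i).le) _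
    rw [hprod] at hbound
    refine (ncard_le_integral_prod_norm_weylSum (m + 1) n P).trans (hbound.trans ?_)
    have h1 : 0 ≤ 1 / (n : ℝ) * ∏ i, (P i : ℝ) := by positivity
    have h2 : 0 ≤ (∏ i, (P i : ℝ)) ^ θ := by positivity
    calc (∏ i, (P i : ℝ)) ^ θ * (l * C) ≤ (l * C + 1) * (∏ i, (P i : ℝ)) ^ θ := by linarith
      _ ≤ (l * C + 1) * (1 / (n : ℝ) * ∏ i, (P i : ℝ) + (∏ i, (P i : ℝ)) ^ θ) := by
          gcongr
          linarith
end

section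
/- Let k ≥ 2 and h > k be integers, let 0 < ε < 1/h, and let l be an integer with 2 ≤ l ≤ h/k. Then there is a constant C (depending on k, h, l, ε) such that for every positive integer n, Σ (x_1·x_2·⋯·x_l)^{−(1/k − 1/h + ε)} ≤ C·n^{−ε}, where the sum runs over all l-tuples (x_1, …, x_l) of elements of (ℤ+)^k with 1 ≤ x_1 < x_2 < … < x_l and x_1 + x_2 + … + x_l = n. -/
/-- The set of k-th powers of positive integers. -/
def kPow (k : ℕ) : Set ℕ := {m | ∃ j : ℕ, 1 ≤ j ∧ m = j ^ k}

open Finset in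
theorem sum_Icc_rpow_sub_one_le {q : ℝ} (hq0 : 0 < q) (hq1 : q ≤ 1) (N : ℕ) :
    ∑ j ∈ Icc 1 N, (j : ℝ) ^ (q - 1) ≤ (N : ℝ) ^ q / q := by
  induction N with
  | zero => simp [hq0.ne']
  | succ N ih =>
    rw [sum_Icc_succ_top (by omega)]
    have hN : (0 : ℝ) < ((N + 1 : ℕ) : ℝ) := by positivity
    set M : ℝ := ((N + 1 : ℕ) : ℝ) with hM
    have hNM : (N : ℝ) = M * (1 + -(1 / M)) := by
      field_simp
      rw [hM]
      push_cast
      ring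
    have hM1 : 1 / M ≤ 1 := by
      rw [div_le_one hN, hM]
      push_cast
      linarith [(Nat.cast_nonneg N : (0 : ℝ) ≤ N)]
    have bernoulli := rpow_one_add_le_one_add_mul_self (s := -(1 / M)) (by linarith)
      hq0.le hq1
    have step : (N : ℝ) ^ q ≤ M ^ q - q * M ^ (q - 1) := by
      rw [hNM, Real.mul_rpow hN.le (by linarith), Real.rpow_sub_one hN.ne']
      calc M ^ q * (1 + -(1 / M)) ^ q ≤ M ^ q * (1 + q * -(1 / M)) := by gcongr
        _ = _ := by ring
    calc _ ≤ (N : ℝ) ^ q / q + M ^ (q - 1) := by gcongr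
      _ ≤ (M ^ q - q * M ^ (q - 1)) / q + M ^ (q - 1) := by gcongr
      _ = M ^ q / q := by field_simp; ring

/-- The `k`-th powers of positive integers which are at most `n`. -/
noncomputable def kPowUpTo (k n : ℕ) : Finset ℕ :=
  (Finset.Icc 1 ⌊(n : ℝ) ^ (1 / (k : ℝ))⌋₊).image (· ^ k)

theorem mem_kPowUpTo {k n y : ℕ} (hk : k ≠ 0) (hy : y ∈ kPow k) (hyn : y ≤ n) :
    y ∈ kPowUpTo k n := by
  obtain ⟨j, hj, rfl⟩ := hy
  refine Finset.mem_image.2 ⟨j, Finset.mem_Icc.2 ⟨hj, Nat.le_floor ?_⟩, rfl⟩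
  rw [one_div, Real.le_rpow_inv_iff_of_pos (by positivity) (by positivity) (by positivity)]
  exact_mod_cast hyn

theorem sum_kPowUpTo_rpow_le {k : ℕ} (hk : k ≠ 0) {s : ℝ} (hs0 : 0 ≤ s) (hs1 : s < 1 / k)
    (n : ℕ) :
    ∑ y ∈ kPowUpTo k n, (y : ℝ) ^ (-s) ≤ (n : ℝ) ^ (1 / (k : ℝ) - s) / (1 - k * s) := by
  have hk0 : (0 : ℝ) < k := by positivity
  have hks : k * s < 1 := by rwa [mul_comm, ← lt_div_iff₀ hk0]
  have hpow : ∀ j : ℕ, ((j ^ k : ℕ) : ℝ) ^ (-s) = (j : ℝ) ^ ((1 - k * s) - 1) := fun j => by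
    rw [Nat.cast_pow, ← Real.rpow_natCast_mul (by positivity)]
    ring_nf
  rw [kPowUpTo, Finset.sum_image fun a _ b _ h => Nat.pow_left_injective hk h]
  simp only [hpow]
  refine (sum_Icc_rpow_sub_one_le (by linarith) (by nlinarith) _).trans ?_
  have hq : 0 < 1 - k * s := by linarith
  calc _ ≤ ((n : ℝ) ^ (1 / (k : ℝ))) ^ (1 - k * s) / (1 - k * s) := by
        gcongr
        exact Nat.floor_le (by positivity)
    _ = _ := by
        rw [← Real.rpow_mul (by positivity)]
        congr 2
        field_simp

theorem last_ge_of_strictMono {m n : ℕ} {x : Fin (m + 1) → ℕ} (hx : StrictMono x)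
    (hsum : ∑ i, x i = n) : (n : ℝ) / (m + 1) ≤ x (Fin.last m) := by
  rw [div_le_iff₀ (by positivity)]
  have h := Finset.sum_le_card_nsmul Finset.univ x (x (Fin.last m))
    fun i _ => hx.monotone (Fin.le_last i)
  rw [hsum] at h
  simp only [Finset.card_univ, Fintype.card_fin, smul_eq_mul] at h
  rw [mul_comm]
  exact_mod_cast h

theorem tsum_prod_rpow_le {k : ℕ} (hk : k ≠ 0) {s : ℝ} (hs0 : 0 ≤ s) (m n : ℕ)
    (hn : 1 ≤ n) :
    (∑' x : {x : Fin (m + 1) → ℕ // StrictMono x ∧ (∀ i, x i ∈ kPow k) ∧ ∑ i, x i = n},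
        (∏ i, (x.1 i : ℝ)) ^ (-s)) ≤
      (∑ y ∈ kPowUpTo k n, (y : ℝ) ^ (-s)) ^ m * ((n : ℝ) / (m + 1)) ^ (-s) := by
  classical
  have hn0 : (0 : ℝ) < n := by exact_mod_cast hn
  refine Real.tsum_le_of_sum_le (fun x => by positivity) fun u => ?_
  let init : {x : Fin (m + 1) → ℕ // StrictMono x ∧ (∀ i, x i ∈ kPow k) ∧ ∑ i, x i = n} →
      Fin m → ℕ := fun x i => x.1 i.castSucc
  have hinj : Function.Injective init := by
    rintro ⟨x, _, _, hx⟩ ⟨y, _, _, hy⟩ hxy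
    have hcast : ∀ i : Fin m, x i.castSucc = y i.castSucc := congrFun hxy
    rw [← hy, Fin.sum_univ_castSucc, Fin.sum_univ_castSucc] at hx
    simp only [hcast, Nat.add_left_cancel_iff] at hx
    exact Subtype.ext (funext (Fin.lastCases hx hcast))
  calc ∑ x ∈ u, (∏ i, (x.1 i : ℝ)) ^ (-s)
      ≤ ∑ x ∈ u, (∏ i, (init x i : ℝ) ^ (-s)) * ((n : ℝ) / (m + 1)) ^ (-s) := by
        refine Finset.sum_le_sum fun x _ => ?_
        rw [← Real.finsetProd_rpow _ _ fun i _ => by positivity, Fin.prod_univ_castSucc]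
        gcongr _ * ?_
        exact Real.rpow_le_rpow_of_nonpos (by positivity)
          (last_ge_of_strictMono x.2.1 x.2.2.2) (by linarith)
    _ = (∑ y ∈ u.image init, ∏ i, (y i : ℝ) ^ (-s)) * ((n : ℝ) / (m + 1)) ^ (-s) := by
        rw [Finset.sum_image hinj.injOn, Finset.sum_mul]
    _ ≤ (∑ y ∈ Fintype.piFinset fun _ : Fin m => kPowUpTo k n, ∏ i, (y i : ℝ) ^ (-s)) *
          ((n : ℝ) / (m + 1)) ^ (-s) := by
        gcongr
        intro y hy
        obtain ⟨x, _, rfl⟩ := Finset.mem_image.1 hy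
        refine Fintype.mem_piFinset.2 fun i => mem_kPowUpTo hk (x.2.2.1 _) ?_
        exact (Finset.single_le_sum (f := x.1) (fun _ _ => Nat.zero_le _)
          (Finset.mem_univ i.castSucc)).trans x.2.2.2.le
    _ = _ := by
        rw [← Finset.prod_univ_sum (fun _ : Fin m => kPowUpTo k n)
          fun _ y => (y : ℝ) ^ (-s)]
        simp

theorem stmt16 (k h : ℕ) (hk : 2 ≤ k) (hkh : k < h)
    (ε : ℝ) (hε0 : 0 < ε) (hε1 : ε < 1 / (h : ℝ))
    (l : ℕ) (hl2 : 2 ≤ l) (hlh : (l : ℝ) ≤ (h : ℝ) / (k : ℝ)) :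
    ∃ C : ℝ, 0 < C ∧ ∀ n : ℕ, 1 ≤ n →
      (∑' x : {x : Fin l → ℕ // StrictMono x ∧ (∀ i, x i ∈ kPow k) ∧
          ∑ i, x i = n},
        (∏ i, (x.1 i : ℝ)) ^ (-(1 / (k : ℝ) - 1 / (h : ℝ) + ε))) ≤
      C * (n : ℝ) ^ (-ε) := by
  obtain ⟨m, rfl⟩ : ∃ m, l = m + 1 := ⟨l - 1, by omega⟩
  have hk0 : (0 : ℝ) < k := by positivity
  have hh0 : (0 : ℝ) < h := by exact_mod_cast (by omega : 0 < h)
  have hinv : 1 / (h : ℝ) < 1 / k :=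
    one_div_lt_one_div_of_lt hk0 (by exact_mod_cast hkh)
  set s : ℝ := 1 / (k : ℝ) - 1 / (h : ℝ) + ε with hs
  have hs0 : 0 ≤ s := by linarith
  have hs1 : s < 1 / k := by linarith
  have hq : 0 < 1 - k * s := by
    rw [lt_div_iff₀ hk0] at hs1
    linarith
  have hexp : (1 / (k : ℝ) - s) * m + -s ≤ -ε := by
    have hle : ((m : ℝ) + 1) * (1 / h) ≤ 1 / k := by
      rw [mul_one_div, div_le_iff₀ hh0, one_div_mul_eq_div]
      exact_mod_cast hlh
    have : 0 ≤ (m : ℝ) * ε := by positivity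
    rw [hs]
    linarith
  refine ⟨(1 / (1 - k * s)) ^ m * (1 / ((m : ℝ) + 1)) ^ (-s), by positivity, fun n hn => ?_⟩
  have hn1 : (1 : ℝ) ≤ n := by exact_mod_cast hn
  have hn0 : (0 : ℝ) < n := by linarith
  calc _ ≤ (∑ y ∈ kPowUpTo k n, (y : ℝ) ^ (-s)) ^ m * ((n : ℝ) / (m + 1)) ^ (-s) :=
        tsum_prod_rpow_le (by omega) hs0 m n hn
    _ ≤ ((n : ℝ) ^ (1 / (k : ℝ) - s) / (1 - k * s)) ^ m * ((n : ℝ) / (m + 1)) ^ (-s) := by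
        gcongr
        exact sum_kPowUpTo_rpow_le (by omega) hs0 hs1 n
    _ = (1 / (1 - k * s)) ^ m * (1 / ((m : ℝ) + 1)) ^ (-s) *
          (n : ℝ) ^ ((1 / (k : ℝ) - s) * m + -s) := by
        rw [div_eq_mul_one_div ((n : ℝ) ^ _), div_eq_mul_one_div (n : ℝ), mul_pow,
          Real.mul_rpow hn0.le (by positivity), Real.rpow_add hn0, Real.rpow_mul_natCast hn0.le]
        ring
    _ ≤ _ := by
        gcongr
end

section
/- Let k ≥ 2 be an integer. There exists a constant h_2(k) = O(8^k·k²) such that for every integer l ≥ h_2(k) and every ε > 0 there is a constant C (depending on k, l, ε) with the following property: for every positive integer n, Σ (y_1·y_2·⋯·y_l)^{−(1 − k/l + kε)} ≤ C·n^{−ε}, where the sum runs over all l-tuples (y_1, …, y_l) of positive integers with 1 ≤ y_1 < y_2 < … < y_l and y_1^k + y_2^k + … + y_l^k = n. -/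
open Finset MeasureTheory Polynomial

namespace WaringSum

theorem exists_card_divisors_le_rpow {ε : ℝ} (hε : 0 < ε) :
    ∃ C : ℝ, 0 < C ∧ ∀ n : ℕ, n ≠ 0 → (#n.divisors : ℝ) ≤ C * (n : ℝ) ^ ε := by
  set c : ℝ := ε * Real.log 2
  have hc : 0 < c := mul_pos hε (Real.log_pos one_lt_two)
  set K : ℝ := 1 + 1 / c
  have hK : 1 ≤ K := le_add_of_nonneg_right (by positivity)
  obtain ⟨B, hB⟩ := exists_nat_ge ((2 : ℝ) ^ (1 / ε))
  have local_bound (p : ℕ) (hp : p.Prime) (v : ℕ) :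
      ((v : ℝ) + 1) ≤ (if p < B then K else 1) * ((p : ℝ) ^ v) ^ ε := by
    have hp2 : (2 : ℝ) ≤ p := mod_cast hp.two_le
    split_ifs with h
    · have h1 : 1 + c * v ≤ ((p : ℝ) ^ v) ^ ε := calc
        1 + c * v ≤ Real.exp (c * v) := by linarith [Real.add_one_le_exp (c * v)]
        _ = ((2 : ℝ) ^ v) ^ ε := by
          rw [Real.rpow_def_of_pos (by positivity), Real.log_pow]; congr 1; ring
        _ ≤ _ := by gcongr
      calc (v : ℝ) + 1 ≤ K * (1 + c * v) := by
            have : K * (1 + c * v) = v + 1 + (c * v + 1 / c) := by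
              simp only [K]; field_simp; ring
            rw [this]; exact le_add_of_nonneg_right (by positivity)
        _ ≤ _ := by gcongr
    · have h1 : (2 : ℝ) ≤ (p : ℝ) ^ ε := by
        have : (2 : ℝ) ^ (1 / ε) ≤ p := hB.trans (mod_cast not_lt.1 h)
        calc (2 : ℝ) = ((2 : ℝ) ^ (1 / ε)) ^ ε := by
              rw [← Real.rpow_mul (by norm_num), one_div_mul_cancel hε.ne', Real.rpow_one]
          _ ≤ _ := by gcongr
      rw [one_mul, ← Real.rpow_natCast, ← Real.rpow_mul (by positivity), mul_comm,
        Real.rpow_mul (by positivity), Real.rpow_natCast]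
      calc (v : ℝ) + 1 ≤ 2 ^ v := mod_cast Nat.lt_two_pow_self
        _ ≤ _ := by gcongr
  refine ⟨K ^ B, by positivity, fun n hn => ?_⟩
  have hprod : (n : ℝ) ^ ε = ∏ p ∈ n.primeFactors, ((p : ℝ) ^ n.factorization p) ^ ε := by
    rw [Real.finsetProd_rpow _ _ (fun _ _ => by positivity)]
    congr 1
    exact_mod_cast (Nat.prod_factorization_pow_eq_self hn).symm
  rw [Nat.card_divisors hn, hprod]
  push_cast
  calc ∏ p ∈ n.primeFactors, ((n.factorization p : ℝ) + 1)
      ≤ ∏ p ∈ n.primeFactors,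
          ((if p < B then K else 1) * ((p : ℝ) ^ n.factorization p) ^ ε) :=
        prod_le_prod (fun _ _ => by positivity)
          fun p hp => local_bound p (Nat.prime_of_mem_primeFactors hp) _
    _ = K ^ #{p ∈ n.primeFactors | p < B} *
          ∏ p ∈ n.primeFactors, ((p : ℝ) ^ n.factorization p) ^ ε := by
        rw [prod_mul_distrib, prod_ite, prod_const, prod_const_one, mul_one]
    _ ≤ _ := by
        gcongr
        calc #{p ∈ n.primeFactors | p < B} ≤ #(range B) :=
              card_le_card fun p hp => by simp_all
          _ = B := card_range B

theorem natDegree_taylor_sub_self {R : Type*} [CommRing R] [IsDomain R] [CharZero R]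
    (q : R[X]) {h : R} (hh : h ≠ 0) :
    (taylor h q - q).natDegree = q.natDegree - 1 := by
  obtain hd | hd := Nat.eq_zero_or_pos q.natDegree
  · rw [eq_C_of_natDegree_eq_zero hd]; simp
  refine natDegree_eq_of_le_of_coeff_ne_zero ?_ ?_
  · refine (natDegree_le_iff_coeff_eq_zero).2 fun n hn => ?_
    obtain rfl | hlt := (show q.natDegree ≤ n by omega).eq_or_lt
    · rw [coeff_sub, coeff_taylor_natDegree, leadingCoeff, sub_self]
    · rw [coeff_sub, coeff_eq_zero_of_natDegree_lt hlt,
        coeff_eq_zero_of_natDegree_lt (by rwa [natDegree_taylor]), sub_zero]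
  · have hlin : hasseDeriv (q.natDegree - 1) q =
        C (q.coeff (q.natDegree - 1)) + C (q.natDegree * q.leadingCoeff) * X := by
      ext i
      rw [hasseDeriv_coeff]
      match i with
      | 0 => simp
      | 1 =>
        have : 1 + (q.natDegree - 1) = q.natDegree := by omega
        have hchoose : q.natDegree.choose (q.natDegree - 1) = q.natDegree := by
          rw [← Nat.choose_symm_of_eq_add this.symm, Nat.choose_one_right]
        simp [this, hchoose, coeff_C]
      | i + 2 =>
        rw [coeff_eq_zero_of_natDegree_lt (n := i + 2 + (q.natDegree - 1)) (by omega)]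
        simp
    rw [coeff_sub, taylor_coeff, hlin]
    have : q.leadingCoeff ≠ 0 := by
      rw [leadingCoeff_ne_zero]; rintro rfl; simp at hd
    simp [hd.ne', this, hh]

theorem integral_fourier_eq (m : ℤ) :
    ∫ θ : UnitAddCircle, fourier m θ ∂AddCircle.haarAddCircle = if m = 0 then 1 else 0 := by
  have h := congr_fun (fourierCoeff_fourier (T := (1 : ℝ)) m) 0
  simp only [fourierCoeff, neg_zero, fourier_zero, one_smul] at h
  rw [h, Pi.single_apply]
  simp [eq_comm]

theorem integrable_of_continuous {E : Type*} [NormedAddCommGroup E] {f : UnitAddCircle → E}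
    (hf : Continuous f) : Integrable f AddCircle.haarAddCircle :=
  hf.integrable_of_hasCompactSupport (HasCompactSupport.of_compactSpace f)

theorem integral_sum_fourier {ι : Type*} (s : Finset ι) (φ : ι → ℤ) :
    ∫ θ : UnitAddCircle, ∑ i ∈ s, fourier (φ i) θ ∂AddCircle.haarAddCircle =
      #{i ∈ s | φ i = 0} := by
  rw [integral_finsetSum _ fun i _ => integrable_of_continuous (fourier (φ i)).continuous]
  simp_rw [integral_fourier_eq]
  simp

/-- The exponential sum `∑ x ∈ I, e(θ q(x))`. -/
noncomputable def expSum (q : ℤ[X]) (I : Finset ℤ) (θ : UnitAddCircle) : ℂ :=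
  ∑ x ∈ I, fourier (q.eval x) θ

/-- The iterated forward difference of `X ^ k` with the given steps. -/
noncomputable def diffPoly (k : ℕ) : List ℤ → ℤ[X]
  | [] => X ^ k
  | h :: t => taylor h (diffPoly k t) - diffPoly k t

/-- The points at which the iterated forward difference only involves arguments in `A`. -/
def diffSupp (A : Finset ℤ) : List ℤ → Finset ℤ
  | [] => A
  | h :: t => {x ∈ diffSupp A t | x + h ∈ diffSupp A t}

/-- Lists of `j` steps of absolute value less than `P`. -/
noncomputable def steps (P : ℕ) : ℕ → Finset (List ℤ)
  | 0 => {[]}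
  | j + 1 => (Ioo (-P : ℤ) P ×ˢ steps P j).image fun p => p.1 :: p.2

theorem continuous_expSum (q : ℤ[X]) (I : Finset ℤ) : Continuous (expSum q I) :=
  continuous_finsetSum _ fun _ _ => (fourier _).continuous

theorem norm_expSum_le (q : ℤ[X]) (I : Finset ℤ) (θ : UnitAddCircle) :
    ‖expSum q I θ‖ ≤ #I := by
  refine (norm_sum_le _ _).trans ?_
  simp [fourier_apply, Circle.norm_coe]

theorem norm_sq_expSum (q : ℤ[X]) {P : ℕ} {I : Finset ℤ} (hI : I ⊆ Icc 1 (P : ℤ))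
    (θ : UnitAddCircle) :
    ((‖expSum q I θ‖ ^ 2 : ℝ) : ℂ) =
      ∑ h ∈ Ioo (-P : ℤ) P, expSum (taylor h q - q) {x ∈ I | x + h ∈ I} θ := by
  rw [Complex.ofReal_pow, ← Complex.conj_mul', expSum, map_sum, sum_mul_sum]
  simp_rw [expSum, ← fourier_neg, ← fourier_add, eval_sub, taylor_eval]
  refine Eq.trans ?_ (sum_comm' (s := Ioo (-P : ℤ) P) (t := fun h => {x ∈ I | x + h ∈ I})
    (s' := fun x => {h ∈ Ioo (-P : ℤ) P | x + h ∈ I}) (t' := I)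
    (by simp only [mem_filter]; tauto)).symm
  refine sum_congr rfl fun x hx => ?_
  refine sum_nbij' (fun y => y - x) (fun h => x + h) ?_ ?_ ?_ ?_ ?_
  · intro y hy
    have h1 := mem_Icc.1 (hI hx)
    have h2 := mem_Icc.1 (hI hy)
    simp only [mem_filter, mem_Ioo, add_sub_cancel, hy, and_true]
    omega
  · simp
  · simp
  · simp
  · intro y _
    rw [add_sub_cancel, neg_add_eq_sub]

theorem diffSupp_subset (A : Finset ℤ) (t : List ℤ) : diffSupp A t ⊆ A := by
  induction t with
  | nil => exact Subset.rfl
  | cons h t ih => exact (filter_subset _ _).trans ih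

theorem sum_steps_succ {M : Type*} [AddCommMonoid M] (P j : ℕ) (f : List ℤ → M) :
    ∑ t ∈ steps P (j + 1), f t = ∑ t ∈ steps P j, ∑ h ∈ Ioo (-P : ℤ) P, f (h :: t) := by
  rw [steps, sum_image (by rintro ⟨a, b⟩ _ ⟨c, d⟩ _ h; simpa using h), sum_product_right]

theorem card_Ioo_neg_le (P : ℕ) : #(Ioo (-P : ℤ) P) ≤ 2 * P := by
  rw [Int.card_Ioo]; omega

theorem card_steps_le (P j : ℕ) : #(steps P j) ≤ (2 * P) ^ j := by
  induction j with
  | zero => simp [steps]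
  | succ j ih =>
    rw [steps, pow_succ']
    refine card_image_le.trans ?_
    rw [card_product]
    exact Nat.mul_le_mul (card_Ioo_neg_le P) ih

theorem length_of_mem_steps {P j : ℕ} {t : List ℤ} (ht : t ∈ steps P j) : t.length = j := by
  induction j generalizing t with
  | zero => simp_all [steps]
  | succ j ih =>
    simp only [steps, mem_image, mem_product] at ht
    obtain ⟨p, ⟨-, hp⟩, rfl⟩ := ht
    simp [ih hp]

/-- Weyl's differencing inequality. -/
theorem norm_expSum_pow_le (k : ℕ) {P : ℕ} (hP : 1 ≤ P) {A : Finset ℤ}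
    (hA : A ⊆ Icc 1 (P : ℤ)) (j : ℕ) (θ : UnitAddCircle) :
    ‖expSum (X ^ k) A θ‖ ^ 2 ^ (j + 1) * (2 * P : ℝ) ^ (j + 2) ≤
      (2 * P : ℝ) ^ 2 ^ (j + 1) *
        (∑ t ∈ steps P (j + 1), expSum (diffPoly k t) (diffSupp A t) θ).re := by
  have diff_step (t : List ℤ) : (∑ h ∈ Ioo (-P : ℤ) P,
      expSum (diffPoly k (h :: t)) (diffSupp A (h :: t)) θ).re =
        ‖expSum (diffPoly k t) (diffSupp A t) θ‖ ^ 2 := by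
    rw [← Complex.ofReal_re (‖expSum (diffPoly k t) (diffSupp A t) θ‖ ^ 2),
      norm_sq_expSum _ ((diffSupp_subset A t).trans hA) θ]
    rfl
  have hP' : (0 : ℝ) < 2 * P := by positivity
  induction j with
  | zero =>
    rw [sum_steps_succ, steps, sum_singleton, diff_step, mul_comm]
    simp [diffPoly, diffSupp]
  | succ j ih =>
    rw [sum_steps_succ, Complex.re_sum]
    simp_rw [diff_step]
    set S := ∑ t ∈ steps P (j + 1), expSum (diffPoly k t) (diffSupp A t) θ
    have hCS : S.re ^ 2 ≤ (2 * P : ℝ) ^ (j + 1) *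
        ∑ t ∈ steps P (j + 1), ‖expSum (diffPoly k t) (diffSupp A t) θ‖ ^ 2 := calc
      S.re ^ 2 ≤ ‖S‖ ^ 2 := sq_le_sq' (by linarith [Complex.abs_re_le_norm S, neg_abs_le S.re])
        ((le_abs_self _).trans (Complex.abs_re_le_norm S))
      _ ≤ (∑ t ∈ steps P (j + 1), ‖expSum (diffPoly k t) (diffSupp A t) θ‖) ^ 2 := by
        gcongr; exact norm_sum_le _ _
      _ ≤ #(steps P (j + 1)) *
          ∑ t ∈ steps P (j + 1), ‖expSum (diffPoly k t) (diffSupp A t) θ‖ ^ 2 :=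
        sq_sum_le_card_mul_sum_sq
      _ ≤ _ := by
        gcongr; exact_mod_cast card_steps_le P (j + 1)
    refine le_of_mul_le_mul_left ?_ (pow_pos hP' (j + 1))
    calc (2 * P : ℝ) ^ (j + 1) *
          (‖expSum (X ^ k) A θ‖ ^ 2 ^ (j + 1 + 1) * (2 * P : ℝ) ^ (j + 1 + 2))
        = (‖expSum (X ^ k) A θ‖ ^ 2 ^ (j + 1) * (2 * P : ℝ) ^ (j + 2)) ^ 2 := by
          rw [pow_succ 2 (j + 1), pow_mul]; ring
      _ ≤ ((2 * P : ℝ) ^ 2 ^ (j + 1) * S.re) ^ 2 := by gcongr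
      _ = (2 * P : ℝ) ^ 2 ^ (j + 1 + 1) * S.re ^ 2 := by
          rw [pow_succ 2 (j + 1), pow_mul _ (2 ^ (j + 1)) 2]; ring
      _ ≤ (2 * P : ℝ) ^ 2 ^ (j + 1 + 1) * ((2 * P : ℝ) ^ (j + 1) *
            ∑ t ∈ steps P (j + 1), ‖expSum (diffPoly k t) (diffSupp A t) θ‖ ^ 2) := by gcongr
      _ = _ := by ring

theorem dvd_eval_diffPoly (k : ℕ) {t : List ℤ} {d : ℤ} (hd : d ∈ t) (x : ℤ) :
    d ∣ (diffPoly k t).eval x := by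
  induction t generalizing x with
  | nil => simp at hd
  | cons h t ih =>
    rw [diffPoly, eval_sub, taylor_eval]
    obtain rfl | hd := List.mem_cons.1 hd
    · simpa using sub_dvd_eval_sub (x + d) x (diffPoly k t)
    · exact dvd_sub (ih hd _) (ih hd _)

theorem natDegree_diffPoly (k : ℕ) {t : List ℤ} (ht : 0 ∉ t) :
    (diffPoly k t).natDegree = k - t.length := by
  induction t with
  | nil => simp [diffPoly]
  | cons h t ih =>
    simp only [List.mem_cons, not_or] at ht
    rw [diffPoly, natDegree_taylor_sub_self _ (Ne.symm ht.1), ih ht.2, List.length_cons,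
      Nat.sub_sub]

theorem card_filter_eval_eq_le (q : ℤ[X]) (hq : 0 < q.natDegree) (I : Finset ℤ) (m : ℤ) :
    #{x ∈ I | q.eval x = m} ≤ q.natDegree := by
  have hne : q - C m ≠ 0 := by
    intro h
    rw [sub_eq_zero.1 h, natDegree_C] at hq
    exact hq.false
  calc #{x ∈ I | q.eval x = m} ≤ #(q - C m).roots.toFinset := by
        refine card_le_card fun x hx => ?_
        rw [Multiset.mem_toFinset, mem_roots hne, IsRoot.def, eval_sub, eval_C,
          (mem_filter.1 hx).2, sub_self]
    _ ≤ Multiset.card (q - C m).roots := Multiset.toFinset_card_le _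
    _ ≤ (q - C m).natDegree := card_roots' _
    _ = q.natDegree := natDegree_sub_C

theorem card_steps_zero_mem_le (P j : ℕ) :
    #{t ∈ steps P j | 0 ∈ t} * (2 * P) ≤ j * (2 * P) ^ j := by
  induction j with
  | zero => simp [steps]
  | succ j ih =>
    have hsub : {t ∈ steps P (j + 1) | 0 ∈ t} ⊆ (steps P j).image (0 :: ·) ∪
        (Ioo (-P : ℤ) P ×ˢ {t ∈ steps P j | 0 ∈ t}).image fun p => p.1 :: p.2 := by
      intro t ht
      simp only [steps, mem_filter, mem_image, mem_product] at ht
      obtain ⟨⟨⟨h, t⟩, ⟨hh, ht⟩, rfl⟩, h0⟩ := ht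
      obtain rfl | h0 := List.mem_cons.1 h0
      · exact mem_union_left _ (mem_image_of_mem _ ht)
      · exact mem_union_right _ (mem_image.2 ⟨(h, t), by simp_all, rfl⟩)
    have hcard : #{t ∈ steps P (j + 1) | 0 ∈ t} ≤
        (2 * P) ^ j + (2 * P) * #{t ∈ steps P j | 0 ∈ t} := by
      refine (card_le_card hsub).trans ((card_union_le _ _).trans (Nat.add_le_add ?_ ?_))
      · exact card_image_le.trans (card_steps_le P j)
      · refine card_image_le.trans ?_
        rw [card_product]
        exact Nat.mul_le_mul_right _ (card_Ioo_neg_le P)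
    calc _ ≤ ((2 * P) ^ j + (2 * P) * #{t ∈ steps P j | 0 ∈ t}) * (2 * P) :=
          Nat.mul_le_mul_right _ hcard
      _ = (2 * P) ^ (j + 1) + (2 * P) * (#{t ∈ steps P j | 0 ∈ t} * (2 * P)) := by ring
      _ ≤ (2 * P) ^ (j + 1) + (2 * P) * (j * (2 * P) ^ j) := by gcongr
      _ = _ := by ring

theorem card_filter_dvd_le (I : Finset ℤ) {m : ℤ} (hm : m ≠ 0) :
    #{d ∈ I | d ∣ m} ≤ 2 * #m.natAbs.divisors := by
  have hsub : {d ∈ I | d ∣ m} ⊆ m.natAbs.divisors.image (fun d : ℕ => (d : ℤ)) ∪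
      m.natAbs.divisors.image (fun d : ℕ => -(d : ℤ)) := by
    intro d hd
    have hdvd := (mem_filter.1 hd).2
    have hmem : d.natAbs ∈ m.natAbs.divisors :=
      Nat.mem_divisors.2 ⟨Int.natAbs_dvd_natAbs.2 hdvd, Int.natAbs_ne_zero.2 hm⟩
    obtain h | h := Int.natAbs_eq d
    · exact mem_union_left _ (mem_image.2 ⟨_, hmem, h.symm⟩)
    · exact mem_union_right _ (mem_image.2 ⟨_, hmem, h.symm⟩)
  refine (card_le_card hsub).trans ((card_union_le _ _).trans ?_)
  rw [two_mul]
  exact Nat.add_le_add card_image_le card_image_le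

theorem card_steps_dvd_le (P j : ℕ) {m : ℤ} (hm : m ≠ 0) :
    #{t ∈ steps P j | ∀ d ∈ t, d ∣ m} ≤ (2 * #m.natAbs.divisors) ^ j := by
  induction j with
  | zero => exact (card_filter_le _ _).trans (by simp [steps])
  | succ j ih =>
    have hsub : {t ∈ steps P (j + 1) | ∀ d ∈ t, d ∣ m} ⊆
        ({d ∈ Ioo (-P : ℤ) P | d ∣ m} ×ˢ {t ∈ steps P j | ∀ d ∈ t, d ∣ m}).image
          fun p => p.1 :: p.2 := by
      intro t ht
      simp only [steps, mem_filter, mem_image, mem_product] at ht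
      obtain ⟨⟨⟨h, t⟩, ⟨hh, ht⟩, rfl⟩, hdvd⟩ := ht
      simp only [List.forall_mem_cons] at hdvd
      exact mem_image.2 ⟨(h, t), by simp only [mem_product, mem_filter]; tauto, rfl⟩
    refine (card_le_card hsub).trans (card_image_le.trans ?_)
    rw [card_product, pow_succ']
    exact Nat.mul_le_mul (card_filter_dvd_le _ hm) ih

theorem sum_card_eval_diffPoly_eq_zero_le {j k : ℕ} (hjk : j < k) {P : ℕ} {A : Finset ℤ}
    (hA : A ⊆ Icc 1 (P : ℤ)) :
    ∑ t ∈ steps P j, #{x ∈ diffSupp A t | (diffPoly k t).eval x = 0} ≤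
      (j + k) * (2 * P) ^ j := by
  rw [← sum_filter_add_sum_filter_not (steps P j) (fun t => 0 ∈ t), add_mul]
  refine Nat.add_le_add ?_ ?_
  · refine (sum_le_card_nsmul _ _ (2 * P) fun t _ => ?_).trans (card_steps_zero_mem_le P j)
    calc _ ≤ #(Icc 1 (P : ℤ)) :=
          card_le_card ((filter_subset _ _).trans ((diffSupp_subset A t).trans hA))
      _ ≤ 2 * P := by rw [Int.card_Icc]; omega
  · refine (sum_le_card_nsmul _ _ k fun t ht => ?_).trans ?_
    · obtain ⟨ht, h0⟩ := mem_filter.1 ht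
      have hdeg := natDegree_diffPoly k h0
      rw [length_of_mem_steps ht] at hdeg
      exact (card_filter_eval_eq_le _ (by omega) _ _).trans (by omega)
    · rw [smul_eq_mul, mul_comm]
      exact Nat.mul_le_mul_left _ ((card_filter_le _ _).trans (card_steps_le P j))

theorem sum_card_eval_diffPoly_eq_le {j k : ℕ} (hjk : j < k) (P : ℕ) (A : Finset ℤ)
    {m : ℤ} (hm : m ≠ 0) :
    ∑ t ∈ steps P j, #{x ∈ diffSupp A t | (diffPoly k t).eval x = m} ≤
      k * (2 * #m.natAbs.divisors) ^ j := by
  rw [← sum_filter_add_sum_filter_not (steps P j) (fun t => ∀ d ∈ t, d ∣ m),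
    sum_eq_zero (s := {t ∈ steps P j | ¬ ∀ d ∈ t, d ∣ m}), add_zero]
  · refine (sum_le_card_nsmul _ _ k fun t ht => ?_).trans ?_
    · obtain ⟨ht, hdvd⟩ := mem_filter.1 ht
      have hdeg := natDegree_diffPoly k (t := t) fun h0 => hm (zero_dvd_iff.1 (hdvd 0 h0))
      rw [length_of_mem_steps ht] at hdeg
      exact (card_filter_eval_eq_le _ (by omega) _ _).trans (by omega)
    · rw [smul_eq_mul, mul_comm]
      exact Nat.mul_le_mul_left _ (card_steps_dvd_le P j hm)
  · intro t ht
    rw [card_eq_zero, filter_eq_empty_iff]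
    rintro x - rfl
    exact (mem_filter.1 ht).2 fun d hd => dvd_eval_diffPoly k hd x

theorem card_filter_add_eq_zero_le {ι κ : Type*} (T : Finset ι) (S : Finset κ) (φ : ι → ℤ)
    (ψ : κ → ℤ) {M : ℝ} (hM0 : 0 ≤ M)
    (hM : ∀ t ∈ T, φ t ≠ 0 → (#{s ∈ S | ψ s = -φ t} : ℝ) ≤ M) :
    (#{p ∈ T ×ˢ S | φ p.1 + ψ p.2 = 0} : ℝ) ≤
      #{t ∈ T | φ t = 0} * #{s ∈ S | ψ s = 0} + #T * M := by
  have hcard : #{p ∈ T ×ˢ S | φ p.1 + ψ p.2 = 0} = ∑ t ∈ T, #{s ∈ S | ψ s = -φ t} := by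
    simp_rw [card_filter, sum_product, eq_neg_iff_add_eq_zero, add_comm]
  rw [hcard, ← sum_filter_add_sum_filter_not T (fun t => φ t = 0)]
  push_cast
  refine add_le_add (le_of_eq ?_) ?_
  · rw [← nsmul_eq_mul]
    exact sum_eq_card_nsmul fun t ht => by simp [(mem_filter.1 ht).2]
  · refine (sum_le_card_nsmul _ _ M fun t ht => hM t (mem_filter.1 ht).1 (mem_filter.1 ht).2).trans ?_
    rw [nsmul_eq_mul]
    gcongr
    exact filter_subset _ _

theorem fourier_sum {ι : Type*} (s : Finset ι) (φ : ι → ℤ) (θ : UnitAddCircle) :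
    fourier (∑ i ∈ s, φ i) θ = ∏ i ∈ s, fourier (φ i) θ := by
  induction s using Finset.cons_induction with
  | empty => simp
  | cons i s hi ih => rw [sum_cons, prod_cons, fourier_add, ih]

theorem norm_expSum_X_pow_pow (k s : ℕ) (A : Finset ℤ) (θ : UnitAddCircle) :
    ((‖expSum (X ^ k) A θ‖ ^ (2 * s) : ℝ) : ℂ) =
      ∑ t ∈ Fintype.piFinset fun _ : Fin s => A ×ˢ A,
        fourier (∑ i, ((t i).2 ^ k - (t i).1 ^ k)) θ := by
  have hsq : ((‖expSum (X ^ k) A θ‖ ^ 2 : ℝ) : ℂ) =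
      ∑ p ∈ A ×ˢ A, fourier (p.2 ^ k - p.1 ^ k) θ := by
    rw [Complex.ofReal_pow, ← Complex.conj_mul', expSum, map_sum, sum_mul_sum, sum_product]
    simp_rw [← fourier_neg, ← fourier_add, eval_pow, eval_X, neg_add_eq_sub]
  rw [pow_mul, Complex.ofReal_pow, hsq]
  simp_rw [fourier_sum]
  rw [← prod_univ_sum (fun _ => A ×ˢ A) fun _ p => fourier (p.2 ^ k - p.1 ^ k) θ, prod_const, card_univ, Fintype.card_fin]

/-- The `p`-th moment of the exponential sum `∑ x ∈ A, e(θ x ^ k)`. -/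
noncomputable def moment (k p : ℕ) (A : Finset ℤ) : ℝ :=
  ∫ θ : UnitAddCircle, ‖expSum (X ^ k) A θ‖ ^ p ∂AddCircle.haarAddCircle

theorem moment_nonneg (k p : ℕ) (A : Finset ℤ) : 0 ≤ moment k p A :=
  integral_nonneg fun _ => by positivity

theorem moment_two_mul (k s : ℕ) (A : Finset ℤ) :
    moment k (2 * s) A = #{t ∈ Fintype.piFinset fun _ : Fin s => A ×ˢ A |
      ∑ i, ((t i).2 ^ k - (t i).1 ^ k) = 0} := by
  rw [← Complex.ofReal_inj, moment, ← integral_complex_ofReal]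
  simp_rw [norm_expSum_X_pow_pow]
  rw [integral_sum_fourier]
  simp

theorem moment_two_le {k P : ℕ} (hk : k ≠ 0) {A : Finset ℤ} (hA : A ⊆ Icc 1 (P : ℤ)) :
    moment k 2 A ≤ P := by
  have h := moment_two_mul k 1 A
  rw [mul_one] at h
  rw [h, Nat.cast_le]
  calc _ ≤ #A := by
        refine card_le_card_of_injOn (fun t => (t 0).1) (fun t ht => ?_) fun t ht u hu htu => ?_
        · simp only [coe_filter, Set.mem_ofPred_eq, Fintype.mem_piFinset, mem_product] at ht
          exact (ht.1 0).1
        · simp only [coe_filter, Set.mem_ofPred_eq, Fintype.mem_piFinset, mem_product,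
            Fin.sum_univ_one] at ht hu
          have snd_eq {v : Fin 1 → ℤ × ℤ} (hv : (∀ i, (v i).1 ∈ A ∧ (v i).2 ∈ A) ∧
              (v 0).2 ^ k - (v 0).1 ^ k = 0) : (v 0).2 = (v 0).1 := by
            have h1 := mem_Icc.1 (hA (hv.1 0).1)
            have h2 := mem_Icc.1 (hA (hv.1 0).2)
            exact (pow_left_inj₀ (by omega) (by omega) hk).1 (sub_eq_zero.1 hv.2)
          funext i
          rw [Subsingleton.elim i 0]
          exact Prod.ext htu (by rw [snd_eq ht, snd_eq hu]; exact htu)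
    _ ≤ #(Icc 1 (P : ℤ)) := card_le_card hA
    _ = P := by simp

theorem abs_sum_sub_pow_le {k P s : ℕ} {A : Finset ℤ} (hA : A ⊆ Icc 1 (P : ℤ))
    {t : Fin s → ℤ × ℤ} (ht : t ∈ Fintype.piFinset fun _ : Fin s => A ×ˢ A) :
    |∑ i, ((t i).2 ^ k - (t i).1 ^ k)| ≤ s * (P : ℤ) ^ k := by
  refine (abs_sum_le_sum_abs _ _).trans ?_
  have : ∀ i ∈ (univ : Finset (Fin s)), |(t i).2 ^ k - (t i).1 ^ k| ≤ (P : ℤ) ^ k := by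
    intro i _
    have h := mem_product.1 (Fintype.mem_piFinset.1 ht i)
    have h1 := mem_Icc.1 (hA h.1)
    have h2 := mem_Icc.1 (hA h.2)
    have h3 : (t i).1 ^ k ≤ (P : ℤ) ^ k := pow_le_pow_left₀ (by omega) h1.2 k
    have h4 : (t i).2 ^ k ≤ (P : ℤ) ^ k := pow_le_pow_left₀ (by omega) h2.2 k
    have h5 : 0 ≤ (t i).1 ^ k := pow_nonneg (by omega) k
    have h6 : 0 ≤ (t i).2 ^ k := pow_nonneg (by omega) k
    rw [abs_le]
    constructor <;> linarith
  simpa using sum_le_card_nsmul univ _ _ this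

theorem moment_two_pow_succ_le {j k P : ℕ} (hP : 1 ≤ P) (hjk : j + 1 < k) {A : Finset ℤ}
    (hA : A ⊆ Icc 1 (P : ℤ)) {B : ℝ} (hB0 : 0 ≤ B)
    (hB : ∀ m : ℕ, m ≠ 0 → m ≤ 2 ^ j * P ^ k → (#m.divisors : ℝ) ≤ B) :
    moment k (2 ^ (j + 2)) A * (2 * P : ℝ) ^ (j + 2) ≤ (2 * P : ℝ) ^ 2 ^ (j + 1) *
      (moment k (2 ^ (j + 1)) A * ((j + 1 + k) * (2 * P : ℝ) ^ (j + 1)) +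
        (P : ℝ) ^ 2 ^ (j + 1) * (k * (2 * B) ^ (j + 1))) := by
  set T := Fintype.piFinset fun _ : Fin (2 ^ j) => A ×ˢ A
  set φ : (Fin (2 ^ j) → ℤ × ℤ) → ℤ := fun t => ∑ i, ((t i).2 ^ k - (t i).1 ^ k)
  set S : Finset (Σ _ : List ℤ, ℤ) := (steps P (j + 1)).sigma (diffSupp A)
  set ψ : (Σ _ : List ℤ, ℤ) → ℤ := fun s => (diffPoly k s.1).eval s.2
  have hcardS (m : ℤ) : #{s ∈ S | ψ s = m} =
      ∑ t ∈ steps P (j + 1), #{x ∈ diffSupp A t | (diffPoly k t).eval x = m} := by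
    simp_rw [card_filter, S, sum_sigma]
    rfl
  have hcardT : #T ≤ P ^ 2 ^ (j + 1) := by
    have : #A ≤ P := (card_le_card hA).trans (by simp)
    rw [Fintype.card_piFinset_const, card_product, pow_succ' 2 j, pow_mul, sq]
    exact Nat.pow_le_pow_left (Nat.mul_le_mul this this) _
  have hcount := card_filter_add_eq_zero_le T S φ ψ (M := k * (2 * B) ^ (j + 1))
    (by positivity) fun t ht hφ => by
      have hle : (φ t).natAbs ≤ 2 ^ j * P ^ k := by
        have := abs_sum_sub_pow_le hA ht (k := k)
        rw [Int.abs_eq_natAbs] at this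
        exact_mod_cast this
      have h := sum_card_eval_diffPoly_eq_le hjk P A (neg_ne_zero.2 hφ)
      rw [hcardS]
      rw [Int.natAbs_neg] at h
      calc _ ≤ (k : ℝ) * (2 * #(φ t).natAbs.divisors) ^ (j + 1) := by exact_mod_cast h
        _ ≤ _ := by gcongr; exact hB _ (Int.natAbs_ne_zero.2 hφ) hle
  have hpoint (θ : UnitAddCircle) :
      ‖expSum (X ^ k) A θ‖ ^ 2 ^ (j + 2) * (2 * P : ℝ) ^ (j + 2) ≤ (2 * P : ℝ) ^ 2 ^ (j + 1) *
        (∑ p ∈ T ×ˢ S, fourier (φ p.1 + ψ p.2) θ).re := by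
    have hsum : ∑ p ∈ T ×ˢ S, fourier (φ p.1 + ψ p.2) θ =
        ((‖expSum (X ^ k) A θ‖ ^ 2 ^ (j + 1) : ℝ) : ℂ) *
          ∑ t ∈ steps P (j + 1), expSum (diffPoly k t) (diffSupp A t) θ := by
      have hS : ∑ t ∈ steps P (j + 1), expSum (diffPoly k t) (diffSupp A t) θ =
          ∑ s ∈ S, fourier (ψ s) θ :=
        (sum_sigma (steps P (j + 1)) (diffSupp A) fun s => fourier (ψ s) θ).symm
      rw [hS, pow_succ' 2 j, norm_expSum_X_pow_pow, sum_mul_sum, sum_product]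
      simp_rw [fourier_add]
      rfl
    rw [hsum, Complex.re_ofReal_mul, pow_succ 2 (j + 1), pow_mul, sq, mul_assoc]
    calc _ ≤ ‖expSum (X ^ k) A θ‖ ^ 2 ^ (j + 1) * _ :=
          mul_le_mul_of_nonneg_left (norm_expSum_pow_le k hP hA j θ) (by positivity)
      _ = _ := by ring
  have hint : moment k (2 ^ (j + 2)) A * (2 * P : ℝ) ^ (j + 2) ≤
      (2 * P : ℝ) ^ 2 ^ (j + 1) * #{p ∈ T ×ˢ S | φ p.1 + ψ p.2 = 0} := by
    have hre : ∫ θ : UnitAddCircle, (∑ p ∈ T ×ˢ S, fourier (φ p.1 + ψ p.2) θ).re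
        ∂AddCircle.haarAddCircle = #{p ∈ T ×ˢ S | φ p.1 + ψ p.2 = 0} := by
      have h := integral_re (𝕜 := ℂ) (μ := AddCircle.haarAddCircle)
        (f := fun θ : UnitAddCircle => ∑ p ∈ T ×ˢ S, fourier (φ p.1 + ψ p.2) θ)
        (integrable_of_continuous (continuous_finsetSum _ fun _ _ => (fourier _).continuous))
      rw [integral_sum_fourier] at h
      simpa using h
    rw [← hre, ← integral_const_mul, moment, ← integral_mul_const]
    refine integral_mono (integrable_of_continuous ?_) (integrable_of_continuous ?_) hpoint
    · exact ((continuous_expSum _ _).norm.pow _).mul continuous_const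
    · exact continuous_const.mul (Complex.continuous_re.comp
        (continuous_finsetSum _ fun _ _ => (fourier _).continuous))
  refine hint.trans (mul_le_mul_of_nonneg_left (hcount.trans (add_le_add ?_ ?_)) (by positivity))
  · rw [hcardS, pow_succ' 2 j, moment_two_mul]
    gcongr
    exact_mod_cast sum_card_eval_diffPoly_eq_zero_le hjk hA
  · gcongr
    exact_mod_cast hcardT

/-- Hua's lemma. -/
theorem exists_moment_two_pow_le (k j : ℕ) (hjk : j < k) {ε : ℝ} (hε : 0 < ε) :
    ∃ C : ℝ, 0 < C ∧ ∀ P : ℕ, 1 ≤ P → ∀ A : Finset ℤ, A ⊆ Icc 1 (P : ℤ) →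
      moment k (2 ^ (j + 1)) A * (P : ℝ) ^ (j + 1) ≤
        C * (P : ℝ) ^ 2 ^ (j + 1) * (P : ℝ) ^ ε := by
  induction j with
  | zero =>
    refine ⟨1, one_pos, fun P hP A hA => ?_⟩
    have hPε : 1 ≤ (P : ℝ) ^ ε := Real.one_le_rpow (mod_cast hP) hε.le
    calc _ ≤ (P : ℝ) * P := by
          simpa using mul_le_mul_of_nonneg_right (moment_two_le hjk.ne' hA) P.cast_nonneg
      _ = (P : ℝ) ^ 2 * 1 := by ring
      _ ≤ (P : ℝ) ^ 2 * (P : ℝ) ^ ε := by gcongr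
      _ = _ := by simp
  | succ j ih =>
    obtain ⟨C, hC, hmom⟩ := ih (by omega)
    set δ : ℝ := ε / (k * (j + 1))
    have hk : (0 : ℝ) < k := mod_cast (by omega : 0 < k)
    have hδ : 0 < δ := by positivity
    obtain ⟨D, hD, hdiv⟩ := exists_card_divisors_le_rpow hδ
    set E : ℝ := D * ((2 : ℝ) ^ j) ^ δ
    refine ⟨2 ^ 2 ^ (j + 1) * (C * ((j + 1 + k) * 2 ^ (j + 1)) + k * (2 * E) ^ (j + 1)),
      by positivity, fun P hP A hA => ?_⟩
    have hB (m : ℕ) (hm : m ≠ 0) (hmP : m ≤ 2 ^ j * P ^ k) :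
        (#m.divisors : ℝ) ≤ E * ((P : ℝ) ^ k) ^ δ := calc
      (#m.divisors : ℝ) ≤ D * (m : ℝ) ^ δ := hdiv m hm
      _ ≤ D * ((2 : ℝ) ^ j * (P : ℝ) ^ k) ^ δ := by gcongr; exact_mod_cast hmP
      _ = _ := by rw [Real.mul_rpow (by positivity) (by positivity), ← mul_assoc]
    have hPε : (((P : ℝ) ^ k) ^ δ) ^ (j + 1) = (P : ℝ) ^ ε := by
      rw [← Real.rpow_natCast_mul (by positivity), ← Real.rpow_mul_natCast (by positivity)]
      congr 1
      simp only [δ]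
      push_cast
      field_simp
    have hmain := moment_two_pow_succ_le hP hjk hA (B := E * ((P : ℝ) ^ k) ^ δ)
      (by positivity) hB
    have hP1 : (1 : ℝ) ≤ P := mod_cast hP
    calc moment k (2 ^ (j + 2)) A * (P : ℝ) ^ (j + 2)
        ≤ moment k (2 ^ (j + 2)) A * (2 * P : ℝ) ^ (j + 2) := by
          gcongr
          · exact moment_nonneg _ _ _
          · linarith
      _ ≤ _ := hmain
      _ = (2 * P : ℝ) ^ 2 ^ (j + 1) * ((moment k (2 ^ (j + 1)) A * (P : ℝ) ^ (j + 1)) *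
            ((j + 1 + k) * 2 ^ (j + 1)) + (P : ℝ) ^ 2 ^ (j + 1) *
            (k * (2 * E) ^ (j + 1) * (P : ℝ) ^ ε)) := by
          rw [← hPε]; ring
      _ ≤ (2 * P : ℝ) ^ 2 ^ (j + 1) * ((C * (P : ℝ) ^ 2 ^ (j + 1) * (P : ℝ) ^ ε) *
            ((j + 1 + k) * 2 ^ (j + 1)) + (P : ℝ) ^ 2 ^ (j + 1) *
            (k * (2 * E) ^ (j + 1) * (P : ℝ) ^ ε)) := by
          refine mul_le_mul_of_nonneg_left (add_le_add ?_ le_rfl) (by positivity)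
          exact mul_le_mul_of_nonneg_right (hmom P hP A hA) (by positivity)
      _ = _ := by rw [pow_succ 2 (j + 1), pow_mul]; ring

theorem rpow_neg_sub_rpow_neg_add_one_le {b x : ℝ} (hb : 0 ≤ b) (hx : 0 < x) :
    x ^ (-b) - (x + 1) ^ (-b) ≤ b * x ^ (-b - 1) := by
  have hlog : Real.log ((x + 1) / x) ≤ 1 / x := by
    refine (Real.log_le_sub_one_of_pos (by positivity)).trans (le_of_eq ?_)
    field_simp
    ring
  have hratio : 1 - b / x ≤ ((x + 1) / x) ^ (-b) := calc
    1 - b / x ≤ 1 + Real.log ((x + 1) / x) * -b := by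
      have := mul_le_mul_of_nonneg_left hlog hb
      rw [mul_one_div] at this
      linarith
    _ ≤ Real.exp (Real.log ((x + 1) / x) * -b) := by
      linarith [Real.add_one_le_exp (Real.log ((x + 1) / x) * -b)]
    _ = _ := (Real.rpow_def_of_pos (by positivity) _).symm
  rw [Real.div_rpow (by positivity) hx.le, le_div_iff₀ (by positivity)] at hratio
  rw [Real.rpow_sub_one hx.ne']
  calc _ ≤ x ^ (-b) - (1 - b / x) * x ^ (-b) := by linarith
    _ = _ := by ring

/-- Summation by parts in a normed space, against the weights `n ^ (-b)`. -/
theorem exists_norm_sum_rpow_smul_le {E : Type*} [NormedAddCommGroup E] [NormedSpace ℝ E]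
    {F : ℕ → E} (hF0 : F 0 = 0) {C σ b : ℝ} (hb : 0 ≤ b) (hσ : σ < b)
    (hF : ∀ n : ℕ, 1 ≤ n → ‖F n‖ ≤ C * (n : ℝ) ^ σ) :
    ∃ K : ℝ, 0 ≤ K ∧ ∀ N : ℕ,
      ‖∑ i ∈ range N, ((i + 1 : ℕ) : ℝ) ^ (-b) • (F (i + 1) - F i)‖ ≤ K := by
  set w : ℕ → ℝ := fun i => ((i + 1 : ℕ) : ℝ) ^ (-b)
  have hC : 0 ≤ C := by simpa using (norm_nonneg _).trans (hF 1 le_rfl)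
  have hparts (N : ℕ) : ∑ i ∈ range (N + 1), w i • (F (i + 1) - F i) =
      w N • F (N + 1) + ∑ i ∈ range N, (w i - w (i + 1)) • F (i + 1) := by
    induction N with
    | zero => simp [hF0]
    | succ N ih => rw [sum_range_succ, ih, sum_range_succ _ N]; module
  have hw (i : ℕ) : |w i - w (i + 1)| ≤ b * ((i + 1 : ℕ) : ℝ) ^ (-b - 1) := by
    rw [abs_of_nonneg]
    · simpa [w] using rpow_neg_sub_rpow_neg_add_one_le hb (x := ((i + 1 : ℕ) : ℝ)) (by positivity)
    · refine sub_nonneg.2 (Real.rpow_le_rpow_of_nonpos (by positivity) ?_ (by linarith))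
      push_cast
      linarith
  set u : ℕ → ℝ := fun i => b * C * ((i + 1 : ℕ) : ℝ) ^ (σ - b - 1)
  have hu : Summable u := by
    refine Summable.mul_left _ ?_
    exact (summable_nat_add_iff 1 (f := fun n : ℕ => (n : ℝ) ^ (σ - b - 1))).2
      (Real.summable_nat_rpow.2 (by linarith))
  have hu0 (i : ℕ) : 0 ≤ u i := by positivity
  refine ⟨C + ∑' i, u i, add_nonneg hC (tsum_nonneg hu0), fun N => ?_⟩
  obtain _ | N := N
  · simpa using add_nonneg hC (tsum_nonneg hu0)
  rw [hparts]
  refine (norm_add_le _ _).trans (add_le_add ?_ ?_)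
  · have hN : (1 : ℝ) ≤ ((N + 1 : ℕ) : ℝ) := by simp
    calc ‖w N • F (N + 1)‖ ≤ ((N + 1 : ℕ) : ℝ) ^ (-b) * (C * ((N + 1 : ℕ) : ℝ) ^ σ) := by
          rw [norm_smul, Real.norm_of_nonneg (by positivity)]
          gcongr
          exact hF _ (by omega)
      _ = C * ((N + 1 : ℕ) : ℝ) ^ (σ - b) := by
          rw [sub_eq_add_neg, Real.rpow_add (by positivity)]; ring
      _ ≤ C * 1 := by gcongr; exact Real.rpow_le_one_of_one_le_of_nonpos hN (by linarith)
      _ = C := mul_one C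
  · refine (norm_sum_le _ _).trans (le_trans (sum_le_sum fun i _ => ?_)
      (hu.sum_le_tsum (range N) fun i _ => hu0 i))
    rw [norm_smul]
    calc _ ≤ b * ((i + 1 : ℕ) : ℝ) ^ (-b - 1) * (C * ((i + 1 : ℕ) : ℝ) ^ σ) := by
          gcongr
          · exact hw i
          · exact hF _ (by omega)
      _ = u i := by
          simp only [u]
          rw [show σ - b - 1 = (-b - 1) + σ by ring, Real.rpow_add (by positivity)]; ring

theorem exists_moment_le (k : ℕ) (hk : 0 < k) {l : ℕ} (hl : 2 ^ k ≤ l) {ε : ℝ} (hε : 0 < ε) :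
    ∃ C : ℝ, 0 < C ∧ ∀ P : ℕ, 1 ≤ P →
      moment k l (Icc 1 (P : ℤ)) ≤ C * (P : ℝ) ^ ((l : ℝ) - k + ε) := by
  obtain ⟨j, rfl⟩ : ∃ j, k = j + 1 := ⟨k - 1, by omega⟩
  obtain ⟨C, hC, hmom⟩ := exists_moment_two_pow_le (j + 1) j (by omega) hε
  refine ⟨C, hC, fun P hP => ?_⟩
  have hP0 : (0 : ℝ) < P := mod_cast hP
  have hle : moment (j + 1) l (Icc 1 (P : ℤ)) ≤
      moment (j + 1) (2 ^ (j + 1)) (Icc 1 (P : ℤ)) * (P : ℝ) ^ (l - 2 ^ (j + 1)) := by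
    rw [moment, moment, ← integral_mul_const]
    refine integral_mono (integrable_of_continuous ((continuous_expSum _ _).norm.pow _))
      (integrable_of_continuous (((continuous_expSum _ _).norm.pow _).mul continuous_const))
      fun θ => ?_
    have hθ : ‖expSum (X ^ (j + 1)) (Icc 1 (P : ℤ)) θ‖ ≤ P := by
      simpa using norm_expSum_le (X ^ (j + 1)) (Icc 1 (P : ℤ)) θ
    calc _ = ‖expSum (X ^ (j + 1)) (Icc 1 (P : ℤ)) θ‖ ^ 2 ^ (j + 1) *
          ‖expSum (X ^ (j + 1)) (Icc 1 (P : ℤ)) θ‖ ^ (l - 2 ^ (j + 1)) := by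
          rw [← pow_add, Nat.add_sub_cancel' hl]
      _ ≤ _ := by gcongr
  refine le_of_mul_le_mul_right ?_ (pow_pos hP0 (j + 1))
  calc _ ≤ (moment (j + 1) (2 ^ (j + 1)) (Icc 1 (P : ℤ)) * (P : ℝ) ^ (j + 1)) *
        (P : ℝ) ^ (l - 2 ^ (j + 1)) := by
        rw [mul_right_comm]; gcongr
    _ ≤ (C * (P : ℝ) ^ 2 ^ (j + 1) * (P : ℝ) ^ ε) * (P : ℝ) ^ (l - 2 ^ (j + 1)) := by
        exact mul_le_mul_of_nonneg_right (hmom P hP _ Subset.rfl) (by positivity)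
    _ = C * ((P : ℝ) ^ 2 ^ (j + 1) * (P : ℝ) ^ (l - 2 ^ (j + 1)) * (P : ℝ) ^ ε) := by ring
    _ = C * ((P : ℝ) ^ l * (P : ℝ) ^ ε) := by rw [← pow_add, Nat.add_sub_cancel' hl]
    _ = _ := by
        rw [mul_assoc, ← Real.rpow_natCast, ← Real.rpow_natCast, ← Real.rpow_add hP0,
          ← Real.rpow_add hP0]
        congr 2
        ring

theorem norm_toLp_pow {l : ℕ} [Fact (1 ≤ (l : ENNReal))] (f : C(UnitAddCircle, ℂ)) :
    ‖ContinuousMap.toLp (l : ENNReal) AddCircle.haarAddCircle ℝ f‖ ^ l =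
      ∫ θ, ‖f θ‖ ^ l ∂AddCircle.haarAddCircle := by
  have hl : l ≠ 0 := by
    rintro rfl
    simpa using Fact.out (p := 1 ≤ ((0 : ℕ) : ENNReal))
  have hae := ContinuousMap.coeFn_toLp (p := (l : ENNReal)) (𝕜 := ℝ)
    (AddCircle.haarAddCircle (T := (1 : ℝ))) f
  have hmem : MemLp f (l : ENNReal) AddCircle.haarAddCircle :=
    (memLp_congr_ae hae).1 (Lp.memLp _)
  have hint : 0 ≤ ∫ θ, ‖f θ‖ ^ l ∂AddCircle.haarAddCircle :=
    integral_nonneg fun _ => by positivity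
  rw [Lp.norm_def, eLpNorm_congr_ae hae,
    hmem.eLpNorm_eq_integral_rpow_norm (by exact_mod_cast hl) (ENNReal.natCast_ne_top l),
    ENNReal.toReal_ofReal (by positivity)]
  simp only [ENNReal.toReal_natCast, Real.rpow_natCast]
  exact Real.rpow_inv_natCast_pow hint hl

theorem sum_range_succ_eq_sum_Icc {M : Type*} [AddCommMonoid M] (f : ℕ → M) (N : ℕ) :
    ∑ i ∈ range N, f (i + 1) = ∑ y ∈ Icc 1 N, f y := by
  rw [range_eq_Ico, sum_Ico_add' f 0 N 1]
  congr 1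

theorem expSum_X_pow_Icc_succ (k N : ℕ) (θ : UnitAddCircle) :
    expSum (X ^ k) (Icc 1 ((N + 1 : ℕ) : ℤ)) θ =
      expSum (X ^ k) (Icc 1 (N : ℤ)) θ + fourier (((N + 1 : ℕ) : ℤ) ^ k) θ := by
  have hins : Icc 1 ((N + 1 : ℕ) : ℤ) = insert ((N + 1 : ℕ) : ℤ) (Icc 1 (N : ℤ)) := by
    ext x
    simp only [mem_insert, mem_Icc]
    omega
  rw [hins, expSum, sum_insert (by simp), add_comm, expSum, eval_pow, eval_X]

/-- The exponential sum over `k`-th powers with the weights `y ^ (-b)`. -/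
noncomputable def weightedSum (k : ℕ) (b : ℝ) (N : ℕ) : C(UnitAddCircle, ℂ) :=
  ∑ y ∈ Icc 1 N, (y : ℝ) ^ (-b) • fourier ((y : ℤ) ^ k)

theorem exists_integral_norm_weightedSum_pow_le {k : ℕ} (hk : 0 < k) {l : ℕ} (hl : 2 ^ k ≤ l)
    {b : ℝ} (hb : 1 - (k : ℝ) / l < b) :
    ∃ K : ℝ, 0 ≤ K ∧ ∀ N : ℕ,
      ∫ θ, ‖weightedSum k b N θ‖ ^ l ∂AddCircle.haarAddCircle ≤ K := by
  have hl0 : 0 < l := (Nat.two_pow_pos k).trans_le hl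
  have hl0' : (0 : ℝ) < l := mod_cast hl0
  have hkl : (k : ℝ) / l ≤ 1 :=
    (div_le_one hl0').2 (mod_cast Nat.lt_two_pow_self.le.trans hl)
  have : Fact (1 ≤ (l : ENNReal)) := ⟨by exact_mod_cast hl0⟩
  set ε : ℝ := l * ((b - (1 - (k : ℝ) / l)) / 2)
  have hε : 0 < ε := mul_pos hl0' (by linarith)
  set σ : ℝ := ((l : ℝ) - k + ε) / l
  have hσ : σ < b := by
    have : σ = 1 - (k : ℝ) / l + (b - (1 - (k : ℝ) / l)) / 2 := by
      simp only [σ, ε]; field_simp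
    linarith
  obtain ⟨C, hC, hmom⟩ := exists_moment_le k hk hl hε
  let T := ContinuousMap.toLp (E := ℂ) (l : ENNReal) (AddCircle.haarAddCircle (T := (1 : ℝ))) ℝ
  let f : ℕ → C(UnitAddCircle, ℂ) := fun n =>
    ⟨expSum (X ^ k) (Icc 1 (n : ℤ)), continuous_expSum _ _⟩
  have hf0 : T (f 0) = 0 := by
    have : f 0 = 0 := by ext θ; simp [f, expSum]
    rw [this, map_zero]
  have hfdiff (n : ℕ) : f (n + 1) - f n = fourier (((n + 1 : ℕ) : ℤ) ^ k) := by
    ext θ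
    simp only [f, ContinuousMap.sub_apply, ContinuousMap.coe_mk, expSum_X_pow_Icc_succ,
      add_sub_cancel_left]
  have hfbound (n : ℕ) (hn : 1 ≤ n) : ‖T (f n)‖ ≤ C ^ (1 / (l : ℝ)) * (n : ℝ) ^ σ := by
    have hpow : ‖T (f n)‖ ^ l ≤ C * (n : ℝ) ^ ((l : ℝ) - k + ε) := by
      rw [norm_toLp_pow]
      exact hmom n hn
    refine le_of_pow_le_pow_left₀ hl0.ne' (by positivity) (hpow.trans_eq ?_)
    rw [mul_pow, ← Real.rpow_mul_natCast hC.le, ← Real.rpow_mul_natCast (by positivity),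
      one_div_mul_cancel hl0'.ne', Real.rpow_one, div_mul_cancel₀ _ hl0'.ne']
  obtain ⟨K, hK, hbound⟩ := exists_norm_sum_rpow_smul_le (F := fun n => T (f n)) hf0
    (by linarith : 0 ≤ b) hσ hfbound
  refine ⟨K ^ l, by positivity, fun N => ?_⟩
  have hW : T (weightedSum k b N) =
      ∑ i ∈ range N, ((i + 1 : ℕ) : ℝ) ^ (-b) • (T (f (i + 1)) - T (f i)) := by
    rw [weightedSum, ← sum_range_succ_eq_sum_Icc, map_sum]
    refine sum_congr rfl fun i _ => ?_
    rw [map_smul, ← map_sub, hfdiff]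
  rw [← norm_toLp_pow]
  gcongr
  exact hW ▸ hbound N

theorem sum_prod_rpow_le_integral (k l : ℕ) (b : ℝ) (N n : ℕ) :
    ∑ y ∈ Fintype.piFinset fun _ : Fin l => Icc 1 N with ∑ i, y i ^ k = n,
      ∏ i, (y i : ℝ) ^ (-b) ≤ ∫ θ, ‖weightedSum k b N θ‖ ^ l ∂AddCircle.haarAddCircle := by
  set Y := Fintype.piFinset fun _ : Fin l => Icc 1 N
  have hexpand (θ : UnitAddCircle) : weightedSum k b N θ ^ l * fourier (-(n : ℤ)) θ =
      ∑ y ∈ Y, ((∏ i, (y i : ℝ) ^ (-b) : ℝ) : ℂ) *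
        fourier (∑ i, (y i : ℤ) ^ k - (n : ℤ)) θ := by
    have hW : weightedSum k b N θ =
        ∑ y ∈ Icc 1 N, (((y : ℝ) ^ (-b) : ℝ) : ℂ) * fourier ((y : ℤ) ^ k) θ := by
      simp [weightedSum]
    have hpow : weightedSum k b N θ ^ l = ∑ y ∈ Y, ∏ i,
        ((((y i : ℝ) ^ (-b) : ℝ) : ℂ) * fourier ((y i : ℤ) ^ k) θ) := by
      rw [← prod_univ_sum (fun _ => Icc 1 N) fun _ (y : ℕ) =>
        (((y : ℝ) ^ (-b) : ℝ) : ℂ) * fourier ((y : ℤ) ^ k) θ, ← hW, prod_const, card_univ,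
        Fintype.card_fin]
    rw [hpow, sum_mul]
    refine sum_congr rfl fun y _ => ?_
    rw [prod_mul_distrib, sub_eq_add_neg, fourier_add, fourier_sum, Complex.ofReal_prod, mul_assoc]
  have hint : ∫ θ, weightedSum k b N θ ^ l * fourier (-(n : ℤ)) θ ∂AddCircle.haarAddCircle =
      ((∑ y ∈ Y with ∑ i, y i ^ k = n, ∏ i, (y i : ℝ) ^ (-b) : ℝ) : ℂ) := by
    simp_rw [hexpand]
    rw [integral_finsetSum Y fun y _ => Integrable.const_mul
      (integrable_of_continuous (fourier _).continuous) _, sum_filter, Complex.ofReal_sum]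
    refine sum_congr rfl fun y _ => ?_
    rw [integral_const_mul, integral_fourier_eq]
    have : (∑ i, (y i : ℤ) ^ k - (n : ℤ) = 0) ↔ ∑ i, y i ^ k = n := by
      rw [sub_eq_zero]; exact_mod_cast Iff.rfl
    simp only [this]
    split_ifs <;> simp
  calc _ ≤ ‖((∑ y ∈ Y with ∑ i, y i ^ k = n, ∏ i, (y i : ℝ) ^ (-b) : ℝ) : ℂ)‖ := by
        rw [Complex.norm_real]; exact Real.le_norm_self _
    _ ≤ ∫ θ, ‖weightedSum k b N θ ^ l * fourier (-(n : ℤ)) θ‖ ∂AddCircle.haarAddCircle := by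
        rw [← hint]; exact norm_integral_le_integral_norm _
    _ = _ := by simp [fourier_apply, Circle.norm_coe]

theorem sum_prod_rpow_init_le {k : ℕ} (hk : k ≠ 0) (m : ℕ) {c : ℝ} (hc : 1 < c) (N n : ℕ) :
    ∑ y ∈ Fintype.piFinset fun _ : Fin (m + 1) => Icc 1 N with ∑ i, y i ^ k = n,
      ∏ i : Fin m, (y i.castSucc : ℝ) ^ (-c) ≤ (∑' x : ℕ, (x : ℝ) ^ (-c)) ^ m := by
  set S := {y ∈ Fintype.piFinset fun _ : Fin (m + 1) => Icc 1 N | ∑ i, y i ^ k = n}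
  have hinj : Set.InjOn (fun (y : Fin (m + 1) → ℕ) (i : Fin m) => y i.castSucc) S := by
    intro y hy z hz hyz
    have hy := (mem_filter.1 hy).2
    have hz := (mem_filter.1 hz).2
    rw [Fin.sum_univ_castSucc] at hy hz
    have hcast (i : Fin m) : y i.castSucc = z i.castSucc := congr_fun hyz i
    simp_rw [hcast] at hy
    have hlast : y (Fin.last m) = z (Fin.last m) :=
      Nat.pow_left_injective hk (by simp only; omega)
    funext i
    exact Fin.lastCases hlast hcast i
  rw [← sum_image (g := fun (y : Fin (m + 1) → ℕ) (i : Fin m) => y i.castSucc)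
    (f := fun z => ∏ i, (z i : ℝ) ^ (-c)) hinj]
  calc _ ≤ ∑ z ∈ Fintype.piFinset fun _ : Fin m => Icc 1 N, ∏ i, (z i : ℝ) ^ (-c) := by
        refine sum_le_sum_of_subset_of_nonneg (fun z hz => ?_) fun _ _ _ => by positivity
        obtain ⟨y, hy, rfl⟩ := mem_image.1 hz
        exact Fintype.mem_piFinset.2 fun i =>
          Fintype.mem_piFinset.1 (mem_filter.1 hy).1 i.castSucc
    _ = (∑ x ∈ Icc 1 N, (x : ℝ) ^ (-c)) ^ m := by
        rw [← prod_univ_sum (fun _ => Icc 1 N) fun _ (x : ℕ) => (x : ℝ) ^ (-c), prod_const,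
          card_univ, Fintype.card_fin]
    _ ≤ _ := by
        gcongr
        exact (Real.summable_nat_rpow.2 (by linarith)).sum_le_tsum _ fun _ _ => by positivity

theorem rpow_neg_le_of_rpow_le {l k : ℕ} (hk : 0 < k) (hl : 0 < l) {ε x Q : ℝ} (hε : 0 ≤ ε)
    (hx : 0 < x) (hQ : x ^ ((l : ℝ) / k ^ 2) ≤ Q) :
    Q ^ (-(1 - (k : ℝ) / l + k * ε)) ≤
      x ^ (-ε) * Q ^ (-(1 - (k : ℝ) / l + k * ε * (1 - k / l))) := by
  have hk' : (0 : ℝ) < k := mod_cast hk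
  have hl' : (0 : ℝ) < l := mod_cast hl
  have hQ0 : 0 < Q := (by positivity : (0 : ℝ) < x ^ ((l : ℝ) / k ^ 2)).trans_le hQ
  have hsplit : -(1 - (k : ℝ) / l + k * ε) =
      -(k ^ 2 * ε / l) + -(1 - (k : ℝ) / l + k * ε * (1 - k / l)) := by
    field_simp; ring
  rw [hsplit, Real.rpow_add hQ0]
  gcongr
  calc Q ^ (-(k ^ 2 * ε / l)) ≤ (x ^ ((l : ℝ) / k ^ 2)) ^ (-(k ^ 2 * ε / l)) :=
        Real.rpow_le_rpow_of_nonpos (by positivity) hQ (neg_nonpos.2 (by positivity))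
    _ = x ^ (-ε) := by
        rw [← Real.rpow_mul hx.le]; congr 1; field_simp

theorem rpow_neg_le_of_le_rpow {l k : ℕ} (hk : 0 < k) (hl : 0 < l) {ε x Q R y : ℝ} (hε : 0 ≤ ε)
    (hx : 0 < x) (hR : 0 < R) (hy : 0 < y) (hQR : Q = R * y) (hQ : Q ≤ x ^ ((l : ℝ) / k ^ 2))
    (hxy : x ≤ l * y ^ k) :
    Q ^ (-(1 - (k : ℝ) / l + k * ε)) ≤
      (l : ℝ) ^ (1 / k + ε) * x ^ (-ε) * R ^ (-(1 + k * ε)) := by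
  have hk' : (0 : ℝ) < k := mod_cast hk
  have hl' : (0 : ℝ) < l := mod_cast hl
  have hQ0 : 0 < Q := hQR ▸ mul_pos hR hy
  have hsmall : Q ^ ((k : ℝ) / l) ≤ x ^ (1 / (k : ℝ)) := calc
    Q ^ ((k : ℝ) / l) ≤ (x ^ ((l : ℝ) / k ^ 2)) ^ ((k : ℝ) / l) := by gcongr
    _ = _ := by rw [← Real.rpow_mul hx.le]; congr 1; field_simp
  have hlarge : y ^ (-(1 + k * ε)) ≤ (l : ℝ) ^ (1 / k + ε) * x ^ (-(1 / k + ε)) := calc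
    y ^ (-(1 + k * ε)) = (y ^ k) ^ (-(1 / k + ε)) := by
      rw [← Real.rpow_natCast_mul hy.le]; congr 1; field_simp
    _ ≤ (x / l) ^ (-(1 / k + ε)) := Real.rpow_le_rpow_of_nonpos (by positivity)
      ((div_le_iff₀' hl').2 hxy) (neg_nonpos.2 (by positivity))
    _ = _ := by
      rw [Real.div_rpow hx.le hl'.le, Real.rpow_neg hl'.le, div_inv_eq_mul, mul_comm]
  rw [show -(1 - (k : ℝ) / l + k * ε) = k / l + -(1 + k * ε) by ring, Real.rpow_add hQ0]
  calc Q ^ ((k : ℝ) / l) * Q ^ (-(1 + k * ε))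
      = Q ^ ((k : ℝ) / l) * (R ^ (-(1 + k * ε)) * y ^ (-(1 + k * ε))) := by
        congr 1; rw [hQR, Real.mul_rpow hR.le hy.le]
    _ ≤ x ^ (1 / (k : ℝ)) * (R ^ (-(1 + k * ε)) *
          ((l : ℝ) ^ (1 / k + ε) * x ^ (-(1 / k + ε)))) := by gcongr
    _ = (l : ℝ) ^ (1 / k + ε) * (x ^ (1 / (k : ℝ)) * x ^ (-(1 / k + ε))) *
          R ^ (-(1 + k * ε)) := by ring
    _ = _ := by rw [← Real.rpow_add hx]; congr 3; ring

end WaringSum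

open WaringSum in
theorem stmt17 :
    ∃ D : ℝ, 0 < D ∧ ∀ k : ℕ, 2 ≤ k →
      ∃ h2 : ℕ, (h2 : ℝ) ≤ D * 8 ^ k * k ^ 2 ∧
        ∀ l : ℕ, h2 ≤ l → ∀ ε : ℝ, 0 < ε →
          ∃ C : ℝ, 0 < C ∧ ∀ n : ℕ, 1 ≤ n →
            (∑' y : {y : Fin l → ℕ // StrictMono y ∧ (∀ i, 1 ≤ y i) ∧
                ∑ i, (y i) ^ k = n},
              (∏ i, (y.1 i : ℝ)) ^ (-(1 - (k : ℝ) / (l : ℝ) + (k : ℝ) * ε))) ≤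
            C * (n : ℝ) ^ (-ε) := by
  refine ⟨1, one_pos, fun k hk => ⟨2 ^ k, ?_, fun l hl ε hε => ?_⟩⟩
  · push_cast
    have h1 : (2 : ℝ) ^ k ≤ 8 ^ k := by gcongr; norm_num
    have h2 : (1 : ℝ) ≤ (k : ℝ) ^ 2 := one_le_pow₀ (by exact_mod_cast (by omega : 1 ≤ k))
    rw [one_mul]
    exact h1.trans (le_mul_of_one_le_right (by positivity) h2)
  have hl0 : 0 < l := (Nat.two_pow_pos k).trans_le hl
  obtain ⟨m, rfl⟩ : ∃ m, l = m + 1 := ⟨l - 1, by omega⟩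
  set l := m + 1
  have hkl : (k : ℝ) / l < 1 :=
    (div_lt_one (mod_cast hl0)).2 (mod_cast Nat.lt_two_pow_self.trans_le hl)
  have hk0 : (0 : ℝ) < k := mod_cast (by omega : 0 < k)
  set a : ℝ := 1 - (k : ℝ) / l + k * ε
  set b : ℝ := 1 - (k : ℝ) / l + k * ε * (1 - k / l)
  obtain ⟨K, hK, hint⟩ := exists_integral_norm_weightedSum_pow_le (by omega) hl
    (lt_add_of_pos_right _ (mul_pos (mul_pos hk0 hε) (sub_pos.2 hkl)) : 1 - (k : ℝ) / l < b)
  set Z : ℝ := ∑' x : ℕ, (x : ℝ) ^ (-(1 + k * ε))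
  have hZ : 0 ≤ Z := tsum_nonneg fun _ => by positivity
  set L : ℝ := (l : ℝ) ^ (1 / k + ε)
  refine ⟨K + L * Z ^ m + 1, by positivity, fun n hn => ?_⟩
  have hn0 : (0 : ℝ) < n := mod_cast hn
  set Y : Finset (Fin l → ℕ) :=
    {y ∈ Fintype.piFinset fun _ : Fin l => Icc 1 n | ∑ i, y i ^ k = n}
  have hpos {y : Fin l → ℕ} (hy : y ∈ Y) (i : Fin l) : (0 : ℝ) < y i :=
    mod_cast (mem_Icc.1 (Fintype.mem_piFinset.1 (mem_filter.1 hy).1 i)).1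
  have htsum : ∑' y : {y : Fin l → ℕ // StrictMono y ∧ (∀ i, 1 ≤ y i) ∧ ∑ i, (y i) ^ k = n},
      (∏ i, (y.1 i : ℝ)) ^ (-a) = ∑ y ∈ Y with StrictMono y, (∏ i, (y i : ℝ)) ^ (-a) := by
    rw [← Finset.tsum_subtype]
    refine (Equiv.subtypeEquivRight fun y => ?_).tsum_eq
      (fun y : {y // y ∈ {y ∈ Y | StrictMono y}} => (∏ i, (y.1 i : ℝ)) ^ (-a))
    simp only [Y, mem_filter, Fintype.mem_piFinset, mem_Icc]
    refine ⟨fun ⟨h1, h2, h3⟩ => ⟨⟨fun i => ⟨h2 i, ?_⟩, h3⟩, h1⟩, fun ⟨⟨h1, h2⟩, h3⟩ => ⟨h3, fun i => (h1 i).1, h2⟩⟩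
    calc y i ≤ y i ^ k := Nat.le_self_pow (by omega) _
      _ ≤ ∑ i, y i ^ k := single_le_sum (f := fun i => y i ^ k) (by simp) (mem_univ i)
      _ = n := h3
  have hterm (y : Fin l → ℕ) (hy : y ∈ {y ∈ Y | StrictMono y}) :
      (∏ i, (y i : ℝ)) ^ (-a) ≤ (n : ℝ) ^ (-ε) * ∏ i, (y i : ℝ) ^ (-b) +
        L * (n : ℝ) ^ (-ε) * ∏ i : Fin m, (y i.castSucc : ℝ) ^ (-(1 + k * ε)) := by
    obtain ⟨hyY, hmono⟩ := mem_filter.1 hy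
    have h1 : 0 ≤ (n : ℝ) ^ (-ε) * ∏ i, (y i : ℝ) ^ (-b) := by positivity
    have h2 : 0 ≤ L * (n : ℝ) ^ (-ε) *
      ∏ i : Fin m, (y i.castSucc : ℝ) ^ (-(1 + k * ε)) := by positivity
    obtain hQ | hQ := le_total ((n : ℝ) ^ ((l : ℝ) / k ^ 2)) (∏ i, (y i : ℝ))
    · refine le_add_of_le_of_nonneg ?_ h2
      rw [Real.finsetProd_rpow _ _ fun i _ => (hpos hyY i).le]
      exact rpow_neg_le_of_rpow_le (by omega) hl0 hε.le hn0 hQ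
    · refine le_add_of_nonneg_of_le h1 ?_
      rw [Real.finsetProd_rpow _ _ fun i _ => (hpos hyY i.castSucc).le]
      refine rpow_neg_le_of_le_rpow (by omega) hl0 hε.le hn0
        (prod_pos fun i _ => hpos hyY i.castSucc) (hpos hyY (Fin.last m))
        (Fin.prod_univ_castSucc _) hQ ?_
      have hsum : ∑ i, y i ^ k ≤ l * y (Fin.last m) ^ k := by
        simpa using sum_le_card_nsmul univ (fun i => y i ^ k) (y (Fin.last m) ^ k) fun i _ =>
          Nat.pow_le_pow_left (hmono.monotone (Fin.le_last i)) k
      rw [(mem_filter.1 hyY).2] at hsum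
      exact_mod_cast hsum
  rw [htsum]
  calc ∑ y ∈ Y with StrictMono y, (∏ i, (y i : ℝ)) ^ (-a)
      ≤ ∑ y ∈ Y with StrictMono y, ((n : ℝ) ^ (-ε) * ∏ i, (y i : ℝ) ^ (-b) +
        L * (n : ℝ) ^ (-ε) * ∏ i : Fin m, (y i.castSucc : ℝ) ^ (-(1 + k * ε))) :=
        sum_le_sum hterm
    _ ≤ ∑ y ∈ Y, ((n : ℝ) ^ (-ε) * ∏ i, (y i : ℝ) ^ (-b) +
        L * (n : ℝ) ^ (-ε) * ∏ i : Fin m, (y i.castSucc : ℝ) ^ (-(1 + k * ε))) :=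
        sum_le_sum_of_subset_of_nonneg (filter_subset _ _) fun _ _ _ => by positivity
    _ = (n : ℝ) ^ (-ε) * ∑ y ∈ Y, ∏ i, (y i : ℝ) ^ (-b) + L * (n : ℝ) ^ (-ε) *
        ∑ y ∈ Y, ∏ i : Fin m, (y i.castSucc : ℝ) ^ (-(1 + k * ε)) := by
        rw [sum_add_distrib, mul_sum, mul_sum]
    _ ≤ (n : ℝ) ^ (-ε) * K + L * (n : ℝ) ^ (-ε) * Z ^ m := by
        gcongr
        · exact (sum_prod_rpow_le_integral k l b n n).trans (hint n)
        · exact sum_prod_rpow_init_le (by omega) m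
            (lt_add_of_pos_right 1 (mul_pos hk0 hε)) n n
    _ ≤ (K + L * Z ^ m + 1) * (n : ℝ) ^ (-ε) := by
        have : 0 ≤ (n : ℝ) ^ (-ε) := by positivity
        linarith
end
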